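/- arXiv:1406.3737 — 2 statements merged into one kernel-verified Lean document; each statement's English description precedes it below -/
import Mathlib

section
/- (Markov's theorem) Let s be a finite positive Borel measure on a compact interval Δ ⊂ ℝ whose support has infinitely many points, and for each n let π_n = P_n/Q_n be the n-th diagonal Padé approximant of ŝ, i.e., deg Q_n ≤ n, deg P_n ≤ n−1, Q_n ≢ 0, and (Q_n ŝ − P_n)(z) = O(1/z^{n+1}) as z → ∞. Then π_n converges to ŝ uniformly on every compact subset of the Riemann sphere minus Δ. -/
open MeasureTheory Polynomial Filter

/-- Cauchy transform of a measure on ℝ. -/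
noncomputable def cauchy (s : Measure ℝ) (z : ℂ) : ℂ := ∫ x, (z - (x : ℂ))⁻¹ ∂s

section
set_option linter.unusedSectionVars false
variable {a b : ℝ} {s : Measure ℝ} [IsFiniteMeasure s]

lemma mk_ae (hsupp : s ((Set.Icc a b)ᶜ) = 0) : ∀ᵐ x ∂s, x ∈ Set.Icc a b := hsupp

lemma mk_int {E : Type*} [NormedAddCommGroup E] (hsupp : s ((Set.Icc a b)ᶜ) = 0)
    {f : ℝ → E} (hf : ContinuousOn f (Set.Icc a b)) : Integrable f s := by
  have h := hf.integrableOn_compact (μ := s) isCompact_Icc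
  rwa [IntegrableOn, Measure.restrict_eq_self_of_ae_mem (mk_ae hsupp)] at h

lemma mk_pos (hsupp : s ((Set.Icc a b)ᶜ) = 0)
    (hinf : ∀ F : Finset ℝ, s ((↑F : Set ℝ))ᶜ ≠ 0) (r : ℝ[X]) (hr : r ≠ 0)
    (h0 : ∀ x ∈ Set.Icc a b, 0 ≤ r.eval x) : ∫ x, r.eval x ∂s ≠ 0 := by
  intro h
  rw [integral_eq_zero_iff_of_nonneg_ae ((mk_ae hsupp).mono h0)
    (mk_int hsupp r.continuous.continuousOn)] at h
  apply hinf r.roots.toFinset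
  refine measure_mono_null ?_ (ae_iff.1 h)
  intro x hx
  simpa [hr] using hx

/-- inv kernel continuity -/
lemma mk_cont {z : ℂ} (hz : ∀ x ∈ Set.Icc a b, z ≠ (x : ℂ)) :
    ContinuousOn (fun x : ℝ => (z - (x : ℂ))⁻¹) (Set.Icc a b) := by
  apply ContinuousOn.inv₀ (by fun_prop)
  intro x hx; exact sub_ne_zero.2 (hz x hx)

/-- orthogonality gives structure of Q -/
lemma mk_roots (hsupp : s ((Set.Icc a b)ᶜ) = 0)
    (hinf : ∀ F : Finset ℝ, s ((↑F : Set ℝ))ᶜ ≠ 0) (n : ℕ) (Q : ℝ[X]) (hQ : Q ≠ 0)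
    (hd : Q.degree ≤ (n : WithBot ℕ))
    (horth : ∀ p : ℝ[X], p.degree < (n : WithBot ℕ) → ∫ x, (Q * p).eval x ∂s = 0) :
    ∃ Z : Finset ℝ, Z.card = n ∧ (∀ x ∈ Z, x ∈ Set.Icc a b) ∧
      Q = C Q.leadingCoeff * Lagrange.nodal Z id := by
  have hnd : Q.natDegree = n := by
    by_contra hne
    have h1 : Q.natDegree ≤ n := natDegree_le_of_degree_le hd
    have h2 : Q.degree < (n : WithBot ℕ) := by
      rw [degree_eq_natDegree hQ]; exact_mod_cast lt_of_le_of_ne h1 hne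
    refine mk_pos hsupp hinf (Q * Q) (mul_ne_zero hQ hQ) ?_ (horth Q h2)
    intro x _; rw [eval_mul]; exact mul_self_nonneg _
  have key : ∀ q r : ℝ[X], Q = q * r → 0 < q.natDegree →
      ¬ ((∀ x ∈ Set.Icc a b, 0 ≤ q.eval x) ∨ (∀ x ∈ Set.Icc a b, q.eval x ≤ 0)) := by
    intro q r hqr hq hor
    have hq0 : q ≠ 0 := by rintro rfl; simp at hq
    have hr0 : r ≠ 0 := by rintro rfl; simp at hqr; exact hQ hqr
    have hrd : r.degree < (n : WithBot ℕ) := by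
      rw [degree_eq_natDegree hr0]
      have := natDegree_mul hq0 hr0
      rw [← hqr, hnd] at this
      exact_mod_cast (by omega : r.natDegree < n)
    have h := horth r hrd
    rcases hor with hor | hor
    · refine mk_pos hsupp hinf (Q * r) (mul_ne_zero hQ hr0) ?_ h
      intro x hx
      rw [hqr, mul_assoc, eval_mul, eval_mul]
      exact mul_nonneg (hor x hx) (mul_self_nonneg _)
    · refine mk_pos hsupp hinf (-(Q * r)) (neg_ne_zero.2 (mul_ne_zero hQ hr0)) ?_ ?_
      · intro x hx
        rw [hqr, mul_assoc, eval_neg, eval_mul, eval_mul]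
        have := mul_nonneg (neg_nonneg.2 (hor x hx)) (mul_self_nonneg (r.eval x))
        linarith
      · simp only [eval_neg, integral_neg, h, neg_zero]
  have hreal : ∀ z : ℂ, aeval z Q = 0 → z.im = 0 := by
    intro z hz
    by_contra him
    obtain ⟨r, hr⟩ := Polynomial.quadratic_dvd_of_aeval_eq_zero_im_ne_zero Q hz him
    refine key _ r hr ?_ (Or.inl ?_)
    · have : (X ^ 2 - C (2 * z.re) * X + C (‖z‖ ^ 2) : ℝ[X]).natDegree = 2 := by
        compute_degree!
      omega
    · intro x _
      have : ‖z‖ ^ 2 = z.re ^ 2 + z.im ^ 2 := by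
        rw [← Complex.normSq_eq_norm_sq, Complex.normSq_apply]; ring
      simp only [eval_add, eval_sub, eval_pow, eval_X, eval_mul, eval_C, this]
      nlinarith [sq_nonneg (x - z.re), sq_nonneg z.im]
  have hIcc : ∀ c ∈ Q.roots, c ∈ Set.Icc a b := by
    intro c hc
    obtain ⟨r, hr⟩ := dvd_iff_isRoot.2 (isRoot_of_mem_roots hc)
    by_contra hn
    refine key _ r hr (by rw [natDegree_X_sub_C]; norm_num) ?_
    simp only [eval_sub, eval_X, eval_C]
    rcases lt_or_ge c a with h | h
    · left; intro x hx; linarith [hx.1]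
    · right; intro x hx
      have : b < c := by by_contra h'; exact hn ⟨h, not_lt.1 h'⟩
      linarith [hx.2]
  have hnodup : Q.roots.Nodup := by
    rw [Multiset.nodup_iff_count_le_one]
    intro c
    by_contra h
    rw [count_roots, not_le] at h
    have h2 : (X - C c) ^ 2 ∣ Q := (le_rootMultiplicity_iff hQ).1 h
    obtain ⟨r, hr⟩ := h2
    refine key _ r hr (by rw [natDegree_pow, natDegree_X_sub_C]; norm_num) (Or.inl ?_)
    intro x _; rw [eval_pow]; exact sq_nonneg _
  have hsplit : Q.Splits := by
    rw [splits_iff_splits]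
    right
    intro g hg hgd
    have hgdeg : g.degree ≠ 0 := (degree_pos_of_irreducible hg).ne'
    obtain ⟨z, hz⟩ := IsAlgClosed.exists_aeval_eq_zero ℂ g hgdeg
    have hz' : aeval z Q = 0 := by
      obtain ⟨r, hr⟩ := hgd; rw [hr, map_mul, hz, zero_mul]
    have him := hreal z hz'
    have hzz : z = ((z.re : ℝ) : ℂ) := by apply Complex.ext <;> simp [him]
    have : g.IsRoot z.re := by
      rw [hzz] at hz
      have := Polynomial.aeval_algebraMap_apply ℂ z.re g
      rw [Complex.coe_algebraMap, hz] at this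
      simpa [aeval_def] using this.symm
    exact degree_eq_one_of_irreducible_of_root hg this
  refine ⟨Q.roots.toFinset, ?_, ?_, ?_⟩
  · rw [Multiset.toFinset_card_of_nodup hnodup, ← hnd]
    exact hsplit.natDegree_eq_card_roots.symm
  · intro x hx; exact hIcc x (by simpa using hx)
  · conv_lhs => rw [hsplit.eq_prod_roots]
    congr 1
    rw [Lagrange.nodal, Finset.prod, Multiset.toFinset_val, hnodup.dedup]
    rfl

lemma mk_gauss (hsupp : s ((Set.Icc a b)ᶜ) = 0)
    (hinf : ∀ F : Finset ℝ, s ((↑F : Set ℝ))ᶜ ≠ 0) (n : ℕ) (hn : 0 < n) (Q : ℝ[X]) (hQ : Q ≠ 0)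
    (hd : Q.degree ≤ (n : WithBot ℕ))
    (horth : ∀ p : ℝ[X], p.degree < (n : WithBot ℕ) → ∫ x, (Q * p).eval x ∂s = 0) :
    ∃ (Z : Finset ℝ) (w : ℝ → ℝ), (∀ x ∈ Z, x ∈ Set.Icc a b) ∧ (∀ x ∈ Z, 0 ≤ w x) ∧
      (∀ x ∈ Z, Q.eval x = 0) ∧ (∀ z : ℂ, aeval z Q = 0 → ∃ x ∈ Z, z = (x : ℂ)) ∧
      (∀ p : ℂ[X], p.natDegree < 2 * n →
        ∫ x, p.eval (x : ℂ) ∂s = ∑ x ∈ Z, (w x : ℂ) * p.eval (x : ℂ)) := by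
  obtain ⟨Z, hZ, hZI, hQZ⟩ := mk_roots hsupp hinf n Q hQ hd horth
  have hlc : Q.leadingCoeff ≠ 0 := leadingCoeff_ne_zero.2 hQ
  have hinj : Set.InjOn (id : ℝ → ℝ) Z := Function.injective_id.injOn
  set N := Lagrange.nodal Z (id : ℝ → ℝ) with hN
  have hNm : N.Monic := Lagrange.nodal_monic
  have hNd : N.natDegree = n := by rw [hN, Lagrange.natDegree_nodal, hZ]
  have hNdeg : N.degree = n := by rw [hN, Lagrange.degree_nodal, hZ]
  have hreal : ∀ p : ℝ[X], p.natDegree < 2 * n → ∫ x, p.eval x ∂s =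
      ∑ x ∈ Z, (∫ y, (Lagrange.basis Z id x).eval y ∂s) * p.eval x := by
    intro p hp
    have hdec := modByMonic_add_div p N
    set r := p %ₘ N
    set u := p /ₘ N
    have hr : r.degree < Z.card := by
      rw [hZ, ← hNdeg]; exact degree_modByMonic_lt _ hNm
    have hu : u.degree < (n : WithBot ℕ) := by
      have : u.natDegree < n := by
        have := natDegree_divByMonic p hNm
        rw [hNd] at this
        change u.natDegree = _ at this
        omega
      exact lt_of_le_of_lt degree_le_natDegree (by exact_mod_cast this)
    have hNu : ∫ x, (N * u).eval x ∂s = 0 := by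
      have h := horth u hu
      have e : ∀ x, (Q * u).eval x = Q.leadingCoeff * (N * u).eval x := by
        intro x
        conv_lhs => rw [hQZ]
        simp [mul_assoc]
      simp_rw [e] at h
      rw [integral_const_mul] at h
      exact (mul_eq_zero.1 h).resolve_left hlc
    have hpr : ∀ x ∈ Z, p.eval x = r.eval x := by
      intro x hx
      have : N.eval x = 0 := Lagrange.eval_nodal_at_node (v := id) hx
      rw [← hdec, eval_add, eval_mul, this]; simp
    have h1 : ∫ x, p.eval x ∂s = ∫ x, r.eval x ∂s := by
      rw [← hdec]
      simp only [eval_add]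
      rw [integral_add (mk_int hsupp r.continuous.continuousOn)
        (mk_int hsupp (N * u).continuous.continuousOn), hNu, add_zero]
    rw [h1]
    have h2 := Lagrange.eq_interpolate hinj hr
    have h3 : ∀ y, r.eval y = ∑ x ∈ Z, (Lagrange.basis Z id x).eval y * p.eval x := by
      intro y
      conv_lhs => rw [h2, Lagrange.interpolate_apply, eval_finsetSum]
      apply Finset.sum_congr rfl
      intro x hx
      simp [hpr x hx, mul_comm]
    simp_rw [h3]
    rw [integral_finsetSum]
    · simp_rw [integral_mul_const]
    · intro x _
      exact (mk_int hsupp (Lagrange.basis Z id x).continuous.continuousOn).mul_const _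
  refine ⟨Z, fun x => ∫ y, (Lagrange.basis Z id x).eval y ∂s, hZI, ?_, ?_, ?_, ?_⟩
  · intro x hx
    have hdg := Lagrange.natDegree_basis hinj hx
    have h := hreal (Lagrange.basis Z id x ^ 2) (by rw [natDegree_pow, hdg, hZ]; omega)
    rw [Finset.sum_eq_single x] at h
    · have e : eval x (Lagrange.basis Z id x) = 1 := Lagrange.eval_basis_self hinj hx
      rw [eval_pow, e, one_pow, mul_one] at h
      show 0 ≤ ∫ y, (Lagrange.basis Z id x).eval y ∂s
      rw [← h]
      apply integral_nonneg
      intro y; simp only [eval_pow]; exact sq_nonneg _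
    · intro y hy hyx
      have : eval y (Lagrange.basis Z id x) = 0 := Lagrange.eval_basis_of_ne (v := id) hyx.symm hy
      rw [eval_pow, this]; simp
    · exact fun h => absurd hx h
  · intro x hx
    have : N.eval x = 0 := Lagrange.eval_nodal_at_node (v := id) hx
    rw [hQZ, eval_mul, this, mul_zero]
  · intro z hz
    rw [hQZ, hN, Lagrange.nodal, map_mul, map_prod] at hz
    simp only [aeval_C, map_sub, aeval_X, id, mul_eq_zero, Finset.prod_eq_zero_iff] at hz
    rcases hz with hz | ⟨x, hx, h⟩
    · simp at hz; exact absurd hz hQ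
    · exact ⟨x, hx, sub_eq_zero.1 h⟩
  · intro p hp
    have hmon : ∀ i < 2 * n, ∫ x : ℝ, (x : ℂ) ^ i ∂s =
        ∑ x ∈ Z, ((∫ y, (Lagrange.basis Z id x).eval y ∂s : ℝ) : ℂ) * (x : ℂ) ^ i := by
      intro i hi
      have h := hreal (X ^ i) (by rw [natDegree_X_pow]; exact hi)
      simp only [eval_pow, eval_X] at h
      have h' := congrArg (fun t : ℝ => (t : ℂ)) h
      simp only [Complex.ofReal_sum, Complex.ofReal_mul, Complex.ofReal_pow] at h'
      rw [← h', ← integral_complex_ofReal]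
      simp
    simp_rw [eval_eq_sum_range' hp]
    rw [integral_finsetSum]
    · simp_rw [integral_const_mul, Finset.mul_sum]
      rw [Finset.sum_comm]
      apply Finset.sum_congr rfl
      intro i hi
      rw [hmon i (Finset.mem_range.1 hi), Finset.mul_sum]
      apply Finset.sum_congr rfl
      intro x _; ring
    · intro i _
      exact mk_int hsupp (by fun_prop)

noncomputable def mkG (s : Measure ℝ) (q : ℝ[X]) (z : ℂ) : ℂ :=
  ∫ x, ((q.eval x : ℝ) : ℂ) * (z - (x : ℂ))⁻¹ ∂s

lemma mkG_int (hsupp : s ((Set.Icc a b)ᶜ) = 0) (q : ℝ[X]) {z : ℂ}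
    (hz : ∀ x ∈ Set.Icc a b, z ≠ (x : ℂ)) :
    Integrable (fun x : ℝ => ((q.eval x : ℝ) : ℂ) * (z - (x : ℂ))⁻¹) s :=
  mk_int hsupp (ContinuousOn.mul
    (Complex.continuous_ofReal.comp q.continuous).continuousOn (mk_cont hz))

lemma mkG_X (hsupp : s ((Set.Icc a b)ᶜ) = 0) (q : ℝ[X]) {z : ℂ}
    (hz : ∀ x ∈ Set.Icc a b, z ≠ (x : ℂ)) :
    mkG s (X * q) z = z * mkG s q z - ((∫ x, q.eval x ∂s : ℝ) : ℂ) := by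
  rw [← integral_complex_ofReal, mkG, mkG, ← integral_const_mul, ← integral_sub
    ((mkG_int hsupp q hz).const_mul z)
    (mk_int hsupp (f := fun x : ℝ => ((q.eval x : ℝ) : ℂ))
      (Complex.continuous_ofReal.comp q.continuous).continuousOn)]
  apply integral_congr_ae
  filter_upwards [mk_ae hsupp] with x hx
  have : z - x ≠ 0 := sub_ne_zero.2 (hz x hx)
  simp only [eval_mul, eval_X, Complex.ofReal_mul]
  field_simp
  ring

lemma mkG_tendsto (hsupp : s ((Set.Icc a b)ᶜ) = 0) (q : ℝ[X]) :
    Tendsto (fun t : ℝ => mkG s q (t : ℂ)) atTop (nhds 0) := by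
  have h1 : Tendsto (fun t : ℝ => (∫ x, ‖q.eval x‖ ∂s) * (t - b)⁻¹) atTop (nhds 0) := by
    rw [← mul_zero (∫ x, ‖q.eval x‖ ∂s)]
    apply Tendsto.const_mul
    exact tendsto_inv_atTop_zero.comp (tendsto_atTop_add_const_right _ (-b) tendsto_id)
  refine squeeze_zero_norm' ?_ h1
  filter_upwards [eventually_gt_atTop b] with t ht
  rw [← integral_mul_const]
  apply norm_integral_le_of_norm_le
  · exact (mk_int hsupp q.continuous.norm.continuousOn).mul_const _
  · filter_upwards [mk_ae hsupp] with x hx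
    rw [norm_mul, norm_inv, Complex.norm_real, ← Complex.ofReal_sub, Complex.norm_real]
    have h2 : t - b ≤ ‖t - x‖ := le_trans (by linarith [hx.2]) (le_abs_self (t - x))
    have : 0 < t - b := by linarith
    gcongr

lemma mkG_poly (hsupp : s ((Set.Icc a b)ᶜ) = 0) (q : ℝ[X]) :
    ∃ S : ℝ[X], ∀ z : ℂ, (∀ x ∈ Set.Icc a b, z ≠ (x : ℂ)) →
      aeval z S = aeval z q * cauchy s z - mkG s q z := by
  induction q using Polynomial.induction_on with
  | C c =>
    refine ⟨0, fun z hz => ?_⟩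
    simp [mkG, cauchy, integral_const_mul]
  | add p q hp hq =>
    obtain ⟨S, hS⟩ := hp
    obtain ⟨T, hT⟩ := hq
    refine ⟨S + T, fun z hz => ?_⟩
    have : mkG s (p + q) z = mkG s p z + mkG s q z := by
      rw [mkG, mkG, mkG, ← integral_add (mkG_int hsupp p hz) (mkG_int hsupp q hz)]
      congr 1; ext x; simp [add_mul]
    rw [map_add, map_add, hS z hz, hT z hz, this]; ring
  | monomial n c h =>
    obtain ⟨S, hS⟩ := h
    refine ⟨X * S + C (∫ x, (C c * X ^ n).eval x ∂s), fun z hz => ?_⟩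
    have e : (C c * X ^ (n + 1) : ℝ[X]) = X * (C c * X ^ n) := by ring
    rw [e, mkG_X hsupp _ hz, map_add, map_mul, map_mul, hS z hz, aeval_C, aeval_X,
      Complex.coe_algebraMap]
    ring

lemma mk_orth (hsupp : s ((Set.Icc a b)ᶜ) = 0) (n : ℕ) (Q P : ℝ[X])
    (hO : ∃ C R : ℝ, ∀ z : ℂ, R ≤ ‖z‖ →
      ‖aeval z Q * cauchy s z - aeval z P‖ ≤ C / ‖z‖ ^ (n + 1)) :
    (∀ z : ℂ, (∀ x ∈ Set.Icc a b, z ≠ (x : ℂ)) →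
      aeval z P = aeval z Q * cauchy s z - mkG s Q z) ∧
    (∀ p : ℝ[X], p.degree < (n : WithBot ℕ) → ∫ x, (Q * p).eval x ∂s = 0) := by
  obtain ⟨K, R, hO⟩ := hO
  have hoff : ∀ t : ℝ, b < t → ∀ x ∈ Set.Icc a b, (t : ℂ) ≠ (x : ℂ) := by
    intro t ht x hx h
    have := Complex.ofReal_injective h
    linarith [hx.2]
  have hlim : ∀ k ≤ n, Tendsto (fun t : ℝ => (t : ℂ) ^ k *
      (aeval (t : ℂ) Q * cauchy s t - aeval (t : ℂ) P)) atTop (nhds 0) := by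
    intro k hk
    have h1 : Tendsto (fun t : ℝ => |K| * t⁻¹) atTop (nhds 0) := by
      rw [← mul_zero |K|]; exact tendsto_inv_atTop_zero.const_mul _
    refine squeeze_zero_norm' ?_ h1
    filter_upwards [eventually_ge_atTop R, eventually_ge_atTop 1] with t ht ht1
    have hnt : ‖(t : ℂ)‖ = t := by
      rw [Complex.norm_real, Real.norm_of_nonneg (by linarith)]
    have h2 := hO t (by rw [hnt]; exact ht)
    rw [hnt] at h2
    rw [norm_mul, norm_pow, hnt]
    have ht0 : 0 < t := by linarith
    calc t ^ k * _ ≤ t ^ n * (|K| / t ^ (n + 1)) := by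
          gcongr
          refine h2.trans ?_
          gcongr
          exact le_abs_self K
      _ = |K| * t⁻¹ := by field_simp; ring
  obtain ⟨S, hS⟩ := mkG_poly hsupp Q
  have hSP : S = P := by
    have h1 : Tendsto (fun t : ℝ => (S - P).eval t) atTop (nhds 0) := by
      rw [tendsto_zero_iff_norm_tendsto_zero]
      have h2 := ((hlim 0 (Nat.zero_le _)).sub (mkG_tendsto hsupp Q)).norm
      rw [sub_zero, norm_zero] at h2
      refine h2.congr' ?_
      filter_upwards [eventually_gt_atTop b] with t ht
      have h3 := hS t (hoff t ht)
      have h4 : (((S - P).eval t : ℝ) : ℂ) = aeval (t : ℂ) S - aeval (t : ℂ) P := by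
        rw [← map_sub]
        have := Polynomial.aeval_algebraMap_apply ℂ t (S - P)
        rw [Complex.coe_algebraMap] at this
        rw [this]; simp
      rw [← Complex.norm_real, h4, h3]
      congr 1; ring
    have := (Polynomial.tendsto_nhds_iff _).1 h1
    exact sub_eq_zero.1 (leadingCoeff_eq_zero.1 this.1)
  subst hSP
  refine ⟨hS, ?_⟩
  have hG : ∀ t : ℝ, b < t → aeval (t : ℂ) Q * cauchy s t - aeval (t : ℂ) S = mkG s Q t := by
    intro t ht; rw [hS t (hoff t ht)]; ring
  have hstep : ∀ k < n, (∀ t : ℝ, b < t → mkG s (X ^ k * Q) t = (t : ℂ) ^ k * mkG s Q t) →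
      ∫ x, (X ^ k * Q).eval x ∂s = 0 := by
    intro k hk h
    have h1 := (hlim (k + 1) hk).sub (mkG_tendsto hsupp (X * (X ^ k * Q)))
    rw [sub_zero] at h1
    have h2 : Tendsto (fun _ : ℝ => ((∫ x, (X ^ k * Q).eval x ∂s : ℝ) : ℂ)) atTop (nhds 0) := by
      refine h1.congr' ?_
      filter_upwards [eventually_gt_atTop b] with t ht
      rw [mkG_X hsupp _ (hoff t ht), h t ht, hG t ht]; ring
    have := tendsto_nhds_unique h2 tendsto_const_nhds
    exact_mod_cast this.symm
  have hind : ∀ k ≤ n, ∀ t : ℝ, b < t → mkG s (X ^ k * Q) t = (t : ℂ) ^ k * mkG s Q t := by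
    intro k
    induction k with
    | zero => intro _ t _; simp
    | succ k ih =>
      intro hk t ht
      have e : (X ^ (k + 1) * Q : ℝ[X]) = X * (X ^ k * Q) := by ring
      rw [e, mkG_X hsupp _ (hoff t ht), hstep k hk (ih (by omega)), ih (by omega) t ht]
      push_cast; ring
  intro p hp
  have hp' : ∀ x, (Q * p).eval x = ∑ i ∈ Finset.range n, p.coeff i * (X ^ i * Q).eval x := by
    intro x
    rcases Nat.eq_zero_or_pos n with h0 | h0
    · subst h0
      have : p = 0 := by
        rw [← degree_eq_bot]; simpa using hp
      simp [this]
    · have : p.natDegree < n := by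
        by_cases hp0 : p = 0
        · simpa [hp0] using h0
        · exact (natDegree_lt_iff_degree_lt hp0).2 hp
      rw [eval_mul, eval_eq_sum_range' this, Finset.mul_sum]
      apply Finset.sum_congr rfl
      intro i _; simp; ring
  simp_rw [hp']
  rw [integral_finsetSum]
  · apply Finset.sum_eq_zero
    intro i hi
    have hi := Finset.mem_range.1 hi
    rw [integral_const_mul, hstep i hi (hind i hi.le), mul_zero]
  · intro i _
    exact (mk_int hsupp (X ^ i * Q).continuous.continuousOn).const_mul _

lemma mk_err (hsupp : s ((Set.Icc a b)ᶜ) = 0)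
    (hinf : ∀ F : Finset ℝ, s ((↑F : Set ℝ))ᶜ ≠ 0) (n : ℕ) (hn : 0 < n) (Q P : ℝ[X])
    (hQ : Q ≠ 0) (hd : Q.degree ≤ (n : WithBot ℕ))
    (hO : ∃ C R : ℝ, ∀ z : ℂ, R ≤ ‖z‖ →
      ‖aeval z Q * cauchy s z - aeval z P‖ ≤ C / ‖z‖ ^ (n + 1))
    (z : ℂ) (hz : ∀ x ∈ Set.Icc a b, z ≠ (x : ℂ)) (p : ℂ[X]) (hp : p.natDegree < 2 * n)
    (ε : ℝ) (hε : ∀ x ∈ Set.Icc a b, ‖(z - (x : ℂ))⁻¹ - p.eval (x : ℂ)‖ ≤ ε) :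
    ‖aeval z P / aeval z Q - cauchy s z‖ ≤ 2 * ε * s.real Set.univ := by
  obtain ⟨hP, horth⟩ := mk_orth hsupp n Q P hO
  obtain ⟨Z, w, hZI, hw, hZ0, hroot, hgauss⟩ := mk_gauss hsupp hinf n hn Q hQ hd horth
  have hQz : aeval z Q ≠ 0 := by
    intro h
    obtain ⟨x, hx, hzx⟩ := hroot z h
    exact hz x (hZI x hx) hzx
  have hev : ∀ x : ℝ, (Q.map (algebraMap ℝ ℂ)).eval (x : ℂ) = ((Q.eval x : ℝ) : ℂ) := by
    intro x
    have := Polynomial.eval_map_apply (f := algebraMap ℝ ℂ) (p := Q) x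
    simpa using this
  -- the partial fraction decomposition
  have hpf : aeval z P / aeval z Q = ∑ x ∈ Z, (w x : ℂ) * (z - (x : ℂ))⁻¹ := by
    set Qc := Q.map (algebraMap ℝ ℂ) with hQc
    have hQcz : Qc.eval z = aeval z Q := by rw [hQc, eval_map_algebraMap]
    obtain ⟨u, hu⟩ : (X - C z) ∣ Qc - C (Qc.eval z) := by
      rw [dvd_iff_isRoot]; simp
    have hud : u.natDegree < 2 * n := by
      by_cases hu0 : u = 0
      · rw [hu0, natDegree_zero]; omega
      have h1 : (Qc - C (Qc.eval z)).natDegree ≤ n := by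
        rw [natDegree_sub_C, hQc]
        exact natDegree_map_le.trans (natDegree_le_of_degree_le hd)
      rw [hu, natDegree_mul (X_sub_C_ne_zero z) hu0, natDegree_X_sub_C] at h1
      omega
    have hux : ∀ x : ℝ, x ∈ Set.Icc a b →
        u.eval (x : ℂ) = (aeval z Q - ((Q.eval x : ℝ) : ℂ)) * (z - (x : ℂ))⁻¹ := by
      intro x hx
      have h := congrArg (eval (x : ℂ)) hu
      simp only [eval_sub, eval_C, eval_mul, eval_X, hev, hQcz] at h
      have : z - x ≠ 0 := sub_ne_zero.2 (hz x hx)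
      field_simp
      linear_combination h
    have hPu : aeval z P = ∫ x : ℝ, u.eval (x : ℂ) ∂s := by
      rw [hP z hz, cauchy, mkG, ← integral_const_mul, ← integral_sub
        ((mk_int hsupp (mk_cont hz)).const_mul _) (mkG_int hsupp Q hz)]
      apply integral_congr_ae
      filter_upwards [mk_ae hsupp] with x hx
      rw [hux x hx]; ring
    rw [hPu, hgauss u hud, Finset.sum_div]
    apply Finset.sum_congr rfl
    intro x hx
    rw [hux x (hZI x hx), hZ0 x hx, Complex.ofReal_zero, sub_zero]
    field_simp
  have hsum : ∑ x ∈ Z, w x = s.real Set.univ := by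
    have h := hgauss 1 (by rw [natDegree_one]; omega)
    simp only [eval_one, mul_one, integral_const] at h
    have h' : ((s.real Set.univ : ℝ) : ℂ) = ((∑ x ∈ Z, w x : ℝ) : ℂ) := by
      rw [Complex.ofReal_sum, ← h]; simp
    exact (Complex.ofReal_injective h').symm
  have h1 : ‖∑ x ∈ Z, (w x : ℂ) * (z - (x : ℂ))⁻¹ - ∑ x ∈ Z, (w x : ℂ) * p.eval (x : ℂ)‖
      ≤ ε * s.real Set.univ := by
    rw [← Finset.sum_sub_distrib, ← hsum, Finset.mul_sum]
    apply norm_sum_le_of_le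
    intro x hx
    rw [← mul_sub, norm_mul, Complex.norm_real, Real.norm_of_nonneg (hw x hx), mul_comm ε]
    exact mul_le_mul_of_nonneg_left (hε x (hZI x hx)) (hw x hx)
  have h2 : ‖cauchy s z - ∫ x : ℝ, p.eval (x : ℂ) ∂s‖ ≤ ε * s.real Set.univ := by
    rw [cauchy, ← integral_sub (mk_int hsupp (mk_cont hz)) (mk_int hsupp
      (f := fun x : ℝ => p.eval (x : ℂ))
      (p.continuous.comp Complex.continuous_ofReal).continuousOn)]
    exact norm_integral_le_of_norm_le_const ((mk_ae hsupp).mono hε)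
  rw [hgauss p hp] at h2
  rw [hpf]
  calc _ = ‖(∑ x ∈ Z, (w x : ℂ) * (z - (x : ℂ))⁻¹ - ∑ x ∈ Z, (w x : ℂ) * p.eval (x : ℂ)) -
        (cauchy s z - ∑ x ∈ Z, (w x : ℂ) * p.eval (x : ℂ))‖ := by congr 1; ring
    _ ≤ _ := norm_sub_le _ _
    _ ≤ 2 * ε * s.real Set.univ := by linarith

lemma mk_approx {z : ℂ} (hz : ∀ x ∈ Set.Icc a b, z ≠ (x : ℂ)) (ε : ℝ) (hε : 0 < ε) :
    ∃ p : ℂ[X], ∀ x ∈ Set.Icc a b, ‖(z - (x : ℂ))⁻¹ - p.eval (x : ℂ)‖ < ε := by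
  have hc := mk_cont hz
  obtain ⟨p, hp⟩ := exists_polynomial_near_of_continuousOn a b
    (fun x => ((z - (x : ℂ))⁻¹).re) (Complex.continuous_re.comp_continuousOn hc) (ε / 2)
    (by linarith)
  obtain ⟨q, hq⟩ := exists_polynomial_near_of_continuousOn a b
    (fun x => ((z - (x : ℂ))⁻¹).im) (Complex.continuous_im.comp_continuousOn hc) (ε / 2)
    (by linarith)
  have hev : ∀ (r : ℝ[X]) (x : ℝ),
      (r.map (algebraMap ℝ ℂ)).eval (x : ℂ) = ((r.eval x : ℝ) : ℂ) := by
    intro r x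
    have := Polynomial.eval_map_apply (f := algebraMap ℝ ℂ) (p := r) x
    simpa using this
  refine ⟨p.map (algebraMap ℝ ℂ) + C Complex.I * q.map (algebraMap ℝ ℂ), fun x hx => ?_⟩
  rw [eval_add, eval_mul, eval_C, hev, hev]
  refine lt_of_le_of_lt (Complex.norm_le_abs_re_add_abs_im _) ?_
  have h1 := hp x hx
  have h2 := hq x hx
  rw [abs_sub_comm] at h1 h2
  simp only [Complex.sub_re, Complex.sub_im, Complex.add_re, Complex.add_im, Complex.mul_re,
    Complex.mul_im, Complex.I_re, Complex.I_im, Complex.ofReal_re, Complex.ofReal_im, zero_mul,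
    one_mul, mul_zero, sub_zero, add_zero, zero_add]
  linarith
end

/-- Markov's theorem: convergence of diagonal Padé approximants on the sphere minus Δ. -/
theorem stmt8 (a b : ℝ) (hab : a < b) (s : Measure ℝ) [IsFiniteMeasure s]
    (hsupp : s ((Set.Icc a b)ᶜ) = 0)
    (hinf : ∀ F : Finset ℝ, s ((↑F : Set ℝ))ᶜ ≠ 0)
    (Q P : ℕ → Polynomial ℝ)
    (hQ0 : ∀ n, Q n ≠ 0)
    (hQdeg : ∀ n, (Q n).degree ≤ ((n : ℕ) : WithBot ℕ))
    (hPdeg : ∀ n, (P n).degree < ((n : ℕ) : WithBot ℕ))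
    (hO : ∀ n, ∃ C R : ℝ, ∀ z : ℂ, R ≤ ‖z‖ →
      ‖aeval z (Q n) * cauchy s z - aeval z (P n)‖ ≤ C / ‖z‖ ^ (n + 1)) :
    (∀ K : Set ℂ, IsCompact K → (∀ z ∈ K, ∀ x ∈ Set.Icc a b, z ≠ (x : ℂ)) →
      TendstoUniformlyOn (fun n z => aeval z (P n) / aeval z (Q n)) (cauchy s) atTop K) ∧
    (∀ ε > (0:ℝ), ∃ R₀ : ℝ, ∀ᶠ n in atTop, ∀ z : ℂ, R₀ ≤ ‖z‖ →
      ‖aeval z (P n) / aeval z (Q n) - cauchy s z‖ < ε) := by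
  have hM : 0 ≤ s.real Set.univ := measureReal_nonneg
  have hδ : ∀ ε > (0:ℝ), ∃ δ > 0, 2 * δ * s.real Set.univ < ε := by
    intro ε hε
    refine ⟨ε / (2 * (s.real Set.univ + 1)), by positivity, ?_⟩
    have : 2 * (ε / (2 * (s.real Set.univ + 1))) * s.real Set.univ
        = ε * (s.real Set.univ / (s.real Set.univ + 1)) := by field_simp
    rw [this]
    have h1 : s.real Set.univ / (s.real Set.univ + 1) < 1 := by
      rw [div_lt_one (by linarith)]; linarith
    nlinarith
  constructor
  · intro K hK hoff
    rw [Metric.tendstoUniformlyOn_iff]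
    intro ε hε
    obtain ⟨δ, hδ0, hδε⟩ := hδ ε hε
    refine hK.induction_on (p := fun T => ∀ᶠ n in atTop, ∀ z ∈ T,
      dist (cauchy s z) (aeval z (P n) / aeval z (Q n)) < ε) ?_ ?_ ?_ ?_
    · simp
    · intro S T hST hT
      exact hT.mono fun n h z hz => h z (hST hz)
    · intro S T hS hT
      filter_upwards [hS, hT] with n h1 h2 z hz
      exact hz.elim (h1 z) (h2 z)
    · intro z₀ hz₀
      obtain ⟨p, hp⟩ := mk_approx (hoff z₀ hz₀) δ hδ0
      have hnb : ∀ᶠ z in nhds z₀, ∀ x ∈ Set.Icc a b,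
          ‖(z - (x : ℂ))⁻¹ - p.eval (x : ℂ)‖ < δ := by
        apply IsCompact.eventually_forall_of_forall_eventually isCompact_Icc
        intro x hx
        have hc : ContinuousAt (fun y : ℂ × ℝ => ‖(y.1 - (y.2 : ℂ))⁻¹ - p.eval (y.2 : ℂ)‖)
            (z₀, x) := by
          apply ContinuousAt.norm
          apply ContinuousAt.sub
          · apply ContinuousAt.inv₀
            · fun_prop
            · exact sub_ne_zero.2 (hoff z₀ hz₀ x hx)
          · exact (p.continuous.comp (Complex.continuous_ofReal.comp continuous_snd)).continuousAt
        exact hc.eventually_lt continuousAt_const (hp x hx)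
      refine ⟨{z | ∀ x ∈ Set.Icc a b, ‖(z - (x : ℂ))⁻¹ - p.eval (x : ℂ)‖ < δ} ∩ K,
        inter_mem (mem_nhdsWithin_of_mem_nhds hnb) self_mem_nhdsWithin, ?_⟩
      filter_upwards [eventually_gt_atTop p.natDegree] with n hn z hz
      rw [dist_comm, dist_eq_norm]
      exact lt_of_le_of_lt (mk_err hsupp hinf n (by omega) (Q n) (P n) (hQ0 n) (hQdeg n) (hO n)
        z (hoff z hz.2) p (by omega) δ (fun x hx => (hz.1 x hx).le)) hδε
  · intro ε hε
    obtain ⟨δ, hδ0, hδε⟩ := hδ ε hε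
    refine ⟨max |a| |b| + δ⁻¹, ?_⟩
    filter_upwards [eventually_gt_atTop 0] with n hn z hz
    have hfar : ∀ x ∈ Set.Icc a b, δ⁻¹ ≤ ‖z - (x : ℂ)‖ := by
      intro x hx
      have h1 : ‖(x : ℂ)‖ ≤ max |a| |b| := by
        rw [Complex.norm_real]; exact abs_le_max_abs_abs hx.1 hx.2
      linarith [norm_sub_norm_le z (x : ℂ)]
    have hδi : 0 < δ⁻¹ := inv_pos.2 hδ0
    refine lt_of_le_of_lt (mk_err hsupp hinf n hn (Q n) (P n) (hQ0 n) (hQdeg n) (hO n)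
        z ?_ 0 (by rw [natDegree_zero]; omega) δ ?_) hδε
    · intro x hx h
      have := hfar x hx
      rw [h, sub_self, norm_zero] at this
      linarith
    · intro x hx
      rw [eval_zero, sub_zero, norm_inv]
      exact inv_le_of_inv_le₀ hδ0 (hfar x hx)
end

section
/- Let Δ ⊂ ℝ be a compact interval and let s be a finite positive Borel measure on Δ with infinitely many points in its support. Suppose (q_n, p_n) are real polynomials with deg p_n ≤ n + κ, deg q_n ≤ n, q_n ≢ 0, and w_n are polynomials with deg w_n ≤ 2n + κ + 1 whose zeros lie in ℝ ∖ Δ, such that (q_n ŝ − p_n)/w_n is holomorphic in ℂ ∖ Δ and is O(1/z^{n+1−ℓ}) at infinity, for fixed integers κ ≥ −1 and ℓ ≥ 0. If the number of zeros of w_n in a fixed bounded segment of ℝ ∖ Δ tends to infinity, then p_n/q_n converges to ŝ in 1-dimensional Hausdorff content inside ℂ ∖ Δ. -/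
open MeasureTheory Polynomial Filter
open scoped Classical

/-- The 1-dimensional Hausdorff content of a set in ℂ. -/
noncomputable def hcont (B : Set ℂ) : ENNReal :=
  ⨅ (c : ℕ → ℂ) (r : ℕ → ℝ) (_ : B ⊆ ⋃ i, Metric.ball (c i) (r i)),
    ∑' i, ENNReal.ofReal (r i)

lemma pade_vit_step (f : ℕ → ℂ → ℂ) (v : ℂ) (r R C : ℝ) (hr : 0 < r) (hrR : r < R)
    (hd : ∀ᶠ n in atTop, DifferentiableOn ℂ (f n) (Metric.closedBall v R))
    (hC : ∀ᶠ n in atTop, ∀ z ∈ Metric.closedBall v R, ‖f n z‖ ≤ C)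
    (h0 : ∀ ε > 0, ∀ᶠ n in atTop, ∀ z ∈ Metric.ball v r, ‖f n z‖ ≤ ε) :
    ∀ ε > 0, ∀ᶠ n in atTop, ∀ z ∈ Metric.ball v (R/2), ‖f n z‖ ≤ ε := by
  have hR : 0 < R := hr.trans hrR
  set a : ℕ → ℕ → ℝ := fun n k => ‖iteratedDeriv k (f n) v‖ / k.factorial * (R/2)^k with ha
  have key : ∀ n k ρ B, 0 < ρ → ρ ≤ R → DifferentiableOn ℂ (f n) (Metric.closedBall v R) →
      (∀ z ∈ Metric.sphere v ρ, ‖f n z‖ ≤ B) → a n k ≤ B / ρ^k * (R/2)^k := by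
    intro n k ρ B hρ hρR hd hB
    have := Complex.norm_iteratedDeriv_le_of_forall_mem_sphere_norm_le k hρ
      (hd.diffContOnCl_ball (Metric.closedBall_subset_closedBall hρR)) hB
    simp only [ha]
    refine mul_le_mul_of_nonneg_right ?_ (by positivity)
    rw [div_le_iff₀ (by positivity)]
    calc _ ≤ _ := this
      _ = _ := by ring
  have hnn : ∀ n k, 0 ≤ a n k := fun n k => by simp only [ha]; positivity
  have hsum : Summable (fun k : ℕ => C * (1/2 : ℝ)^k) :=
    (summable_geometric_of_lt_one (by norm_num) (by norm_num)).mul_left C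
  have hbd : ∀ᶠ n in atTop, ∀ k, ‖a n k‖ ≤ C * (1/2:ℝ)^k := by
    filter_upwards [hd, hC] with n h1 h2 k
    rw [Real.norm_of_nonneg (hnn n k)]
    refine (key n k R C hR le_rfl h1 fun z hz => h2 z (Metric.sphere_subset_closedBall hz)).trans ?_
    rw [div_mul_eq_mul_div, mul_div_assoc, ← div_pow]
    apply le_of_eq
    congr 2
    field_simp
  have hlim : ∀ k, Tendsto (fun n => a n k) atTop (nhds 0) := by
    intro k
    rw [Metric.tendsto_nhds]
    intro ε hε
    set c := (R/2)^k / (r/2)^k with hc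
    have hcpos : 0 < c := by positivity
    filter_upwards [hd, h0 (ε / (2*c)) (by positivity)] with n h1 h2
    have := key n k (r/2) (ε/(2*c)) (by positivity) (by linarith) h1 (fun z hz => h2 z (by
      rw [mem_sphere_iff_norm] at hz
      rw [mem_ball_iff_norm]; linarith))
    rw [Real.dist_eq, sub_zero, abs_of_nonneg (hnn n k)]
    have e : ε / (2 * c) / (r / 2) ^ k * (R / 2) ^ k = ε / 2 := by
      have : ε / (2 * c) / (r / 2) ^ k * (R / 2) ^ k = ε / (2 * c) * c := by rw [hc]; ring
      rw [this]; field_simp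
    rw [e] at this
    linarith
  have hT := tendsto_tsum_of_dominated_convergence hsum hlim hbd
  rw [tsum_zero, Metric.tendsto_nhds] at hT
  intro ε hε
  filter_upwards [hd, hbd, hT ε hε] with n h1 h2 h3 z hz
  have hs := Complex.hasSum_taylorSeries_on_ball (h1.mono Metric.ball_subset_closedBall)
    (Metric.ball_subset_ball (by linarith : R/2 ≤ R) hz)
  have hsa : Summable (a n) := Summable.of_norm_bounded hsum h2
  have : ‖f n z‖ ≤ ∑' k, a n k := by
    rw [← hs.tsum_eq]
    refine tsum_of_norm_bounded hsa.hasSum fun k => ?_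
    simp only [ha, norm_smul, norm_inv, norm_pow, Complex.norm_natCast]
    rw [mem_ball_iff_norm] at hz
    calc _ = ‖iteratedDeriv k (f n) v‖ / k.factorial * ‖z - v‖^k := by ring
      _ ≤ _ := by gcongr
  rw [Real.dist_eq, sub_zero] at h3
  exact this.trans ((le_abs_self _).trans h3.le)

lemma pade_vitali (U : Set ℂ) (hU : IsOpen U) (hUc : IsPreconnected U) (f : ℕ → ℂ → ℂ)
    (hd : ∀ᶠ n in atTop, DifferentiableOn ℂ (f n) U)
    (hC : ∀ K ⊆ U, IsCompact K → ∃ C, ∀ᶠ n in atTop, ∀ z ∈ K, ‖f n z‖ ≤ C)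
    (e : ℂ) (heU : e ∈ U) (r : ℝ) (hr : 0 < r)
    (h0 : ∀ ε > 0, ∀ᶠ n in atTop, ∀ z ∈ Metric.ball e r, ‖f n z‖ ≤ ε) :
    ∀ K ⊆ U, IsCompact K → ∀ ε > 0, ∀ᶠ n in atTop, ∀ z ∈ K, ‖f n z‖ ≤ ε := by
  set V : Set ℂ := {v | ∃ r > 0, ∀ ε > 0, ∀ᶠ n in atTop, ∀ z ∈ Metric.ball v r, ‖f n z‖ ≤ ε} with hV
  have hVo : IsOpen V := by
    rw [Metric.isOpen_iff]
    rintro v ⟨r, hr, h⟩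
    refine ⟨r/2, by positivity, fun u hu => ⟨r/2, by positivity, fun ε hε => ?_⟩⟩
    filter_upwards [h ε hε] with n hn z hz
    refine hn z ?_
    rw [Metric.mem_ball] at *
    linarith [dist_triangle z u v]
  have hsub : U ⊆ V := by
    refine hUc.subset_of_closure_inter_subset hVo ⟨e, heU, r, hr, h0⟩ ?_
    rintro z ⟨hzV, hzU⟩
    obtain ⟨R, hR, hRU⟩ := Metric.isOpen_iff.1 hU z hzU
    obtain ⟨v, hv, hvz⟩ := Metric.mem_closure_iff.1 hzV (R/8) (by positivity)
    obtain ⟨r, hr, h⟩ := hv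
    have hcb : Metric.closedBall v (R/2) ⊆ U := by
      intro u hu
      apply hRU
      rw [Metric.mem_closedBall] at hu
      rw [Metric.mem_ball]
      linarith [dist_triangle u v z, dist_comm z v]
    obtain ⟨C, hC'⟩ := hC _ hcb (isCompact_closedBall v (R/2))
    have := pade_vit_step f v (min r (R/4)) (R/2) C (by positivity)
      (by linarith [min_le_right r (R/4)]) (hd.mono fun n hn => hn.mono hcb) hC'
      (fun ε hε => (h ε hε).mono fun n hn z hz =>
        hn z (Metric.ball_subset_ball (min_le_left _ _) hz))
    refine ⟨R/8, by positivity, fun ε hε => (this ε hε).mono fun n hn u hu => hn u ?_⟩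
    rw [Metric.mem_ball] at *
    linarith [dist_triangle u z v]
  intro K hK hKc ε hε
  refine hKc.induction_on (p := fun K => ∀ᶠ n in atTop, ∀ z ∈ K, ‖f n z‖ ≤ ε) (by simp) ?_ ?_ ?_
  · intro s t hst ht
    exact ht.mono fun n hn z hz => hn z (hst hz)
  · intro s t hs ht
    filter_upwards [hs, ht] with n h1 h2 z hz
    exact hz.elim (h1 z) (h2 z)
  · intro x hx
    obtain ⟨r, hr, h⟩ := hsub (hK hx)
    exact ⟨Metric.ball x r, mem_nhdsWithin_of_mem_nhds (Metric.ball_mem_nhds x hr), h ε hε⟩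

/-- complement of the real interval in the plane -/
def padeU (a b : ℝ) : Set ℂ := {z : ℂ | ∀ x ∈ Set.Icc a b, z ≠ (x : ℂ)}

lemma padeU_eq (a b : ℝ) : padeU a b = (Complex.ofReal '' Set.Icc a b)ᶜ := by
  ext z
  simp only [padeU, Set.mem_ofPred_eq, Set.mem_compl_iff, Set.mem_image, not_exists, not_and]
  exact ⟨fun h x hx e => h x hx e.symm, fun h x hx e => h x hx e.symm⟩

lemma padeU_open (a b : ℝ) : IsOpen (padeU a b) := by
  rw [padeU_eq]
  exact ((isCompact_Icc.image Complex.continuous_ofReal).isClosed).isOpen_compl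

lemma padeU_preconn (a b : ℝ) : IsPreconnected (padeU a b) := by
  have e : padeU a b = ({z : ℂ | 0 < z.im} ∪ {z | z.re < a}) ∪ ({z | z.im < 0} ∪ {z : ℂ | b < z.re}) := by
    ext z
    simp only [padeU, Set.mem_ofPred_eq, Set.mem_union]
    constructor
    · intro h
      by_contra hc
      push Not at hc
      obtain ⟨⟨h1, h2⟩, h3, h4⟩ := hc
      exact h z.re ⟨h2, h4⟩ (Complex.ext (by simp) (by simp; linarith))
    · rintro h x ⟨h1, h2⟩ rfl
      simp at h
      rcases h with h | h <;> linarith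
  have c1 : IsPreconnected {z : ℂ | 0 < z.im} := (convex_halfSpace_im_gt 0).isPreconnected
  have c2 : IsPreconnected {z : ℂ | z.im < 0} := (convex_halfSpace_im_lt 0).isPreconnected
  have c3 : IsPreconnected {z : ℂ | z.re < a} := (convex_halfSpace_re_lt a).isPreconnected
  have c4 : IsPreconnected {z : ℂ | b < z.re} := (convex_halfSpace_re_gt b).isPreconnected
  rw [e]
  refine IsPreconnected.union (⟨a - 1, -1⟩ : ℂ) (by simp) (by simp)
    (IsPreconnected.union (⟨a - 1, 1⟩ : ℂ) (by simp) (by simp) c1 c3)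
    (IsPreconnected.union (⟨b + 1, -1⟩ : ℂ) (by simp) (by simp) c2 c4)

lemma pade_growth (G : ℝ[X]) (hG : G ≠ 0) (l : ℕ) (hl : G.natDegree ≤ l) :
    ∃ (M : ℝ) (Z : Multiset ℂ), 0 < M ∧ Z.card ≤ l ∧
      (∀ z : ℂ, ‖aeval z G‖ ≤ M * (1 + ‖z‖)^l) ∧
      (∀ z : ℂ, ∀ R τ : ℝ, 0 < τ → ‖z‖ ≤ R → (∀ ζ ∈ Z, τ ≤ ‖z - ζ‖) →
        M * (τ / (1 + R + τ))^l ≤ ‖aeval z G‖) := by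
  set P : ℂ[X] := G.map (algebraMap ℝ ℂ) with hP
  have hP0 : P ≠ 0 := by
    rw [hP]; exact (Polynomial.map_ne_zero_iff (algebraMap ℝ ℂ).injective).2 hG
  have hs := (IsAlgClosed.splits P).eq_prod_roots
  have hcard : P.roots.card ≤ l := (P.card_roots').trans (by rw [hP, natDegree_map]; exact hl)
  have hev : ∀ z : ℂ, ‖aeval z G‖ = ‖P.leadingCoeff‖ * (P.roots.map (fun ζ => ‖z - ζ‖)).prod := by
    intro z
    have h1 : aeval z G = P.eval z := by rw [hP, eval_map_algebraMap]
    rw [h1]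
    conv_lhs => rw [hs]
    rw [eval_mul, eval_C, norm_mul, eval_multiset_prod, Multiset.map_map]
    congr 1
    rw [← coe_nnnorm]
    have := map_multiset_prod (nnnormHom : ℂ →*₀ NNReal) (P.roots.map (eval z ∘ fun a => X - C a))
    simp only [nnnormHom_apply] at this
    rw [this, ← NNReal.coe_toRealHom, map_multiset_prod]
    simp [Multiset.map_map, Function.comp_def]
  have hlc : 0 < ‖P.leadingCoeff‖ := by simpa using hP0
  set M0 := (P.roots.map (fun ζ => 1 + ‖ζ‖)).prod with hM0
  have hgen : ∀ (Z : Multiset ℂ), 0 < (Z.map (fun ζ => 1 + ‖ζ‖)).prod := by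
    intro Z
    induction Z using Multiset.induction with
    | empty => simp
    | cons a Z ih => simp only [Multiset.map_cons, Multiset.prod_cons]; positivity
  refine ⟨‖P.leadingCoeff‖ * M0, P.roots, mul_pos hlc (hgen _), hcard, ?_, ?_⟩
  · intro z
    rw [hev, mul_assoc]
    refine mul_le_mul_of_nonneg_left ?_ hlc.le
    have : ∀ (Z : Multiset ℂ), (Z.map (fun ζ => ‖z - ζ‖)).prod ≤
        (Z.map (fun ζ => 1 + ‖ζ‖)).prod * (1 + ‖z‖)^Z.card := by
      intro Z
      induction Z using Multiset.induction with
      | empty => simp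
      | cons a Z ih =>
        simp only [Multiset.map_cons, Multiset.prod_cons, Multiset.card_cons]
        have h1 : ‖z - a‖ ≤ (1 + ‖a‖) * (1 + ‖z‖) := by
          nlinarith [norm_sub_le z a, norm_nonneg z, norm_nonneg a, mul_nonneg (norm_nonneg z) (norm_nonneg a)]
        calc _ ≤ ((1 + ‖a‖) * (1 + ‖z‖)) * ((Z.map (fun ζ => 1 + ‖ζ‖)).prod * (1 + ‖z‖)^Z.card) :=
              mul_le_mul h1 ih (Multiset.prod_nonneg (by simp +contextual [Multiset.mem_map])) (by positivity)
          _ = _ := by ring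
    refine (this _).trans (mul_le_mul_of_nonneg_left ?_ (hgen _).le)
    exact pow_le_pow_right₀ (by linarith [norm_nonneg z]) hcard
  · intro z R τ hτ hzR hZ
    rw [hev, mul_assoc]
    refine mul_le_mul_of_nonneg_left ?_ hlc.le
    have hR : 0 ≤ R := (norm_nonneg z).trans hzR
    have h0 : 0 ≤ τ / (1 + R + τ) := by positivity
    have h1 : τ / (1 + R + τ) ≤ 1 := by rw [div_le_one (by positivity)]; linarith
    have : ∀ (Z : Multiset ℂ), (∀ ζ ∈ Z, τ ≤ ‖z - ζ‖) →
        (Z.map (fun ζ => 1 + ‖ζ‖)).prod * (τ / (1 + R + τ))^Z.card ≤ (Z.map (fun ζ => ‖z - ζ‖)).prod := by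
      intro Z
      induction Z using Multiset.induction with
      | empty => simp
      | cons a Z ih =>
        intro h
        have ih' := ih fun ζ hζ => h ζ (Multiset.mem_cons_of_mem hζ)
        have ha := h a (Multiset.mem_cons_self a Z)
        simp only [Multiset.map_cons, Multiset.prod_cons, Multiset.card_cons]
        have h2 : (1 + ‖a‖) * (τ / (1 + R + τ)) ≤ ‖z - a‖ := by
          rw [← mul_div_assoc, div_le_iff₀ (by positivity)]
          have : ‖a‖ ≤ R + ‖z - a‖ := by
            have := norm_sub_le z (z - a); simp at this; linarith
          nlinarith
        calc _ = ((1 + ‖a‖) * (τ / (1 + R + τ))) * ((Z.map (fun ζ => 1 + ‖ζ‖)).prod * (τ / (1 + R + τ))^Z.card) := by ring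
          _ ≤ _ := mul_le_mul h2 ih' (mul_nonneg (hgen _).le (by positivity)) (norm_nonneg _)
    refine le_trans (mul_le_mul_of_nonneg_left ?_ (hgen _).le) (this _ hZ)
    exact pow_le_pow_of_le_one h0 h1 hcard

lemma pade_hcont_le (B : Set ℂ) (Z : Multiset ℂ) (l : ℕ) (hl : Z.card ≤ l) (τ : ℝ)
    (hB : ∀ z ∈ B, ∃ ζ ∈ Z, ‖z - ζ‖ < τ) : hcont B ≤ l * ENNReal.ofReal τ := by
  unfold hcont
  refine iInf_le_of_le (fun i => Z.toList.getD i 0) ?_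
  refine iInf_le_of_le (fun i => if i < l then τ else 0) ?_
  refine iInf_le_of_le ?_ ?_
  · intro z hz
    obtain ⟨ζ, hζ, h⟩ := hB z hz
    rw [← Multiset.mem_toList] at hζ
    obtain ⟨i, hi, rfl⟩ := List.mem_iff_getElem.1 hζ
    rw [Set.mem_iUnion]
    refine ⟨i, ?_⟩
    have hil : i < l := by rw [Multiset.length_toList] at hi; omega
    simp only [hil, if_true]
    rw [mem_ball_iff_norm, List.getD_eq_getElem _ _ hi]
    exact h
  · rw [tsum_eq_sum (s := Finset.range l)]
    · rw [Finset.sum_congr rfl (g := fun _ => ENNReal.ofReal τ)]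
      · simp
      · intro i hi
        simp [Finset.mem_range.1 hi]
    · intro i hi
      simp at hi
      simp [not_lt.2 hi]

lemma pade_const_sign (a b : ℝ) (g : ℝ[X]) (h : ∀ x ∈ Set.Icc a b, g.eval x ≠ 0) :
    (∀ x ∈ Set.Icc a b, 0 < g.eval x) ∨ (∀ x ∈ Set.Icc a b, g.eval x < 0) := by
  by_contra hc
  push Not at hc
  obtain ⟨⟨x, hx, hx'⟩, y, hy, hy'⟩ := hc
  have := isPreconnected_Icc.intermediate_value (s := Set.Icc a b) hx hy g.continuous.continuousOn
  obtain ⟨z, hz, hz'⟩ := this ⟨hx', hy'⟩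
  exact h z hz hz'

lemma pade_sign (a b : ℝ) : ∀ (k : ℕ) (q : ℝ[X]), q ≠ 0 → q.natDegree = k →
    ∃ (S : Finset ℝ) (g : ℝ[X]), (∀ x ∈ S, x ∈ Set.Icc a b) ∧ q = Lagrange.nodal S id * g ∧
    ((∀ x ∈ Set.Icc a b, 0 ≤ g.eval x) ∨ (∀ x ∈ Set.Icc a b, g.eval x ≤ 0)) := by
  intro k
  induction k with
  | zero =>
    intro q hq hk
    refine ⟨∅, q, by simp, by simp, ?_⟩
    have h : ∀ x ∈ Set.Icc a b, q.eval x ≠ 0 := by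
      intro x _ hx
      rw [eq_C_of_natDegree_eq_zero hk] at hx hq
      simp at hx hq
      exact hq hx
    exact (pade_const_sign a b q h).imp (fun h x hx => (h x hx).le) (fun h x hx => (h x hx).le)
  | succ k ih =>
    intro q hq hk
    by_cases h : ∀ x ∈ Set.Icc a b, q.eval x ≠ 0
    · refine ⟨∅, q, by simp, by simp, ?_⟩
      exact (pade_const_sign a b q h).imp (fun h x hx => (h x hx).le) (fun h x hx => (h x hx).le)
    · push Not at h
      obtain ⟨x, hx, hx0⟩ := h
      obtain ⟨q', rfl⟩ := dvd_iff_isRoot.2 hx0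
      have hq' : q' ≠ 0 := right_ne_zero_of_mul hq
      rw [natDegree_mul (X_sub_C_ne_zero x) hq', natDegree_X_sub_C] at hk
      obtain ⟨S, g, hS, rfl, hg⟩ := ih q' hq' (by omega)
      by_cases hxS : x ∈ S
      · refine ⟨S.erase x, (X - C x)^2 * g, fun y hy => hS y (Finset.mem_of_mem_erase hy), ?_, ?_⟩
        · rw [Lagrange.nodal_eq_mul_nodal_erase hxS]; simp; ring
        · refine hg.imp (fun h y hy => ?_) (fun h y hy => ?_)
          · simp; exact mul_nonneg (sq_nonneg _) (h y hy)
          · simp; exact mul_nonpos_of_nonneg_of_nonpos (sq_nonneg _) (h y hy)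
      · refine ⟨insert x S, g, ?_, ?_, hg⟩
        · intro y hy
          rcases Finset.mem_insert.1 hy with rfl | hy
          · exact hx
          · exact hS y hy
        · rw [Lagrange.nodal_insert_eq_nodal hxS]; simp; ring

/-- Hermite-interpolation bound. -/
lemma pade_hermite (x0 : ℂ) (ρ δ R0 : ℝ) (hρ : 0 < ρ) (hδ : 0 < δ) (Y : Set ℂ)
    (hY : ∀ y ∈ Y, y ∈ Metric.closedBall x0 ρ ∧ ‖y‖ ≤ R0 ∧ ∀ t ∈ Metric.sphere x0 ρ, δ ≤ ‖t - y‖)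
    (R : ℝ) (D : ℕ) :
    ∃ K : ℝ, 0 ≤ K ∧ ∀ (ys : List ℂ) (P : ℂ[X]) (f H : ℂ → ℂ) (M : ℝ), (∀ y ∈ ys, y ∈ Y) →
      ys.length = D → P.degree < D → DifferentiableOn ℂ H (Metric.closedBall x0 ρ) →
      (∀ z ∈ Metric.closedBall x0 ρ, f z = P.eval z + (ys.map (fun y => z - y)).prod * H z) →
      (∀ z ∈ Metric.closedBall x0 ρ, ‖f z‖ ≤ M) →
      ∀ z, ‖z‖ ≤ R → ‖P.eval z‖ ≤ K * M := by
  induction D with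
  | zero =>
    refine ⟨0, le_rfl, ?_⟩
    intro ys P f H M _ _ hP _ _ _ z _
    have : P = 0 := by simpa using hP
    simp [this]
  | succ D ih =>
    obtain ⟨K, hK0, hK⟩ := ih
    refine ⟨1 + (|R| + |R0|) * (K * (2 / δ)), by positivity, ?_⟩
    intro ys P f H M hys hlen hP hH hf hM z hz
    obtain ⟨y, ys, rfl⟩ : ∃ y ys', ys = y :: ys' := by
      cases ys with
      | nil => simp at hlen
      | cons y ys => exact ⟨y, ys, rfl⟩
    have hyY := hys y (by simp)
    obtain ⟨hyB, hyR, hyδ⟩ := hY y hyY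
    have hM0 : 0 ≤ M := (norm_nonneg _).trans (hM y hyB)
    have hfy : f y = P.eval y := by rw [hf y hyB]; simp
    obtain ⟨P1, hP1⟩ : X - C y ∣ P - C (P.eval y) := X_sub_C_dvd_sub_C_eval
    have hPz : ∀ z, P.eval z = P.eval y + (z - y) * P1.eval z := by
      intro z
      have := congrArg (eval z) hP1
      simp at this
      linear_combination this
    have hdeg : P1.degree < D := by
      by_cases h0 : P1 = 0
      · rw [h0]; simp
      have hne : P - C (P.eval y) ≠ 0 := by
        rw [hP1]; exact mul_ne_zero (X_sub_C_ne_zero y) h0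
      have h1 : (P - C (P.eval y)).degree < (D + 1 : ℕ) := by
        refine lt_of_le_of_lt (degree_sub_le _ _) (max_lt hP ?_)
        exact lt_of_le_of_lt degree_C_le (by exact_mod_cast Nat.succ_pos D)
      rw [← natDegree_lt_iff_degree_lt hne, hP1, natDegree_mul (X_sub_C_ne_zero y) h0, natDegree_X_sub_C] at h1
      rw [← natDegree_lt_iff_degree_lt h0]
      omega
    set f1 : ℂ → ℂ := fun z => P1.eval z + (ys.map (fun y => z - y)).prod * H z with hf1
    have hff : ∀ z ∈ Metric.closedBall x0 ρ, f z - f y = (z - y) * f1 z := by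
      intro z hz
      rw [hf z hz, hfy, hPz z, hf1]
      simp only [List.map_cons, List.prod_cons]
      ring
    have hlist : ∀ ys : List ℂ, Differentiable ℂ (fun z => (ys.map (fun y => z - y)).prod) := by
      intro ys
      induction ys with
      | nil => simp
      | cons y ys ih => simp only [List.map_cons, List.prod_cons]; fun_prop
    have hd1 : DifferentiableOn ℂ f1 (Metric.closedBall x0 ρ) :=
      (P1.differentiable.differentiableOn).add ((hlist ys).differentiableOn.mul hH)
    have hb1 : ∀ z ∈ Metric.closedBall x0 ρ, ‖f1 z‖ ≤ 2 / δ * M := by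
      intro z hz
      refine Complex.norm_le_of_forall_mem_frontier_norm_le (U := Metric.ball x0 ρ) Metric.isBounded_ball
        (hd1.diffContOnCl_ball le_rfl) ?_ (by rwa [closure_ball x0 hρ.ne'])
      intro t ht
      rw [frontier_ball x0 hρ.ne'] at ht
      have h1 := hyδ t ht
      have h2 := hff t (Metric.sphere_subset_closedBall ht)
      have h3 : ‖t - y‖ * ‖f1 t‖ ≤ 2 * M := by
        rw [← norm_mul, ← h2]
        refine (norm_sub_le _ _).trans ?_
        linarith [hM t (Metric.sphere_subset_closedBall ht), hM y hyB]
      have h4 : δ * ‖f1 t‖ ≤ 2 * M := (mul_le_mul_of_nonneg_right h1 (norm_nonneg _)).trans h3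
      rw [div_mul_eq_mul_div, le_div_iff₀ hδ]
      linarith
    have := hK ys P1 f1 H (2 / δ * M) (fun y hy => hys y (by simp [hy])) (by simpa using hlen) hdeg hH
      (fun z hz => rfl) hb1 z hz
    rw [hPz z]
    refine (norm_add_le _ _).trans ?_
    rw [norm_mul, ← hfy]
    have hzy : ‖z - y‖ ≤ |R| + |R0| := (norm_sub_le _ _).trans (add_le_add (hz.trans (le_abs_self _)) (hyR.trans (le_abs_self _)))
    calc _ ≤ M + (|R| + |R0|) * (K * (2 / δ * M)) :=
          add_le_add (hM y hyB) (mul_le_mul hzy this (norm_nonneg _) (by positivity))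
      _ = _ := by ring

lemma pade_small (x0 : ℂ) (ρ θ : ℝ) (hρ : 0 < ρ) (hθ : 0 ≤ θ) (z : ℂ) (hz : z ∈ Metric.closedBall x0 ρ)
    (ys : List ℂ) (hys : ∀ y ∈ ys, ∀ t ∈ Metric.sphere x0 ρ, ‖z - y‖ ≤ θ * ‖t - y‖)
    (f H : ℂ → ℂ) (M : ℝ) (hH : DifferentiableOn ℂ H (Metric.closedBall x0 ρ))
    (hf : ∀ z ∈ Metric.closedBall x0 ρ, f z = (ys.map (fun y => z - y)).prod * H z)
    (hM : ∀ z ∈ Metric.closedBall x0 ρ, ‖f z‖ ≤ M) : ‖f z‖ ≤ θ ^ ys.length * M := by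
  rw [hf z hz]
  have := Complex.norm_le_of_forall_mem_frontier_norm_le (U := Metric.ball x0 ρ)
    (f := fun t => (ys.map (fun y => z - y)).prod * H t) (C := θ ^ ys.length * M) Metric.isBounded_ball
    ((hH.const_mul _).diffContOnCl_ball le_rfl) ?_ (z := z) (by rwa [closure_ball x0 hρ.ne'])
  · exact this
  intro t ht
  rw [frontier_ball x0 hρ.ne'] at ht
  have h1 : ∀ l : List ℂ, (∀ y ∈ l, ∀ t ∈ Metric.sphere x0 ρ, ‖z - y‖ ≤ θ * ‖t - y‖) →
      ‖(l.map (fun y => z - y)).prod‖ ≤ θ ^ l.length * ‖(l.map (fun y => t - y)).prod‖ := by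
    intro l
    induction l with
    | nil => simp
    | cons y l ih =>
      intro h
      simp only [List.map_cons, List.prod_cons, norm_mul, List.length_cons]
      calc _ ≤ (θ * ‖t - y‖) * (θ ^ l.length * ‖(l.map (fun y => t - y)).prod‖) :=
            mul_le_mul (h y (by simp) t ht) (ih fun y hy => h y (by simp [hy])) (norm_nonneg _) (by positivity)
        _ = _ := by ring
  rw [norm_mul]
  calc _ ≤ (θ ^ ys.length * ‖(ys.map (fun y => t - y)).prod‖) * ‖H t‖ :=
        mul_le_mul_of_nonneg_right (h1 ys hys) (norm_nonneg _)
    _ = θ ^ ys.length * ‖f t‖ := by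
        rw [hf t (Metric.sphere_subset_closedBall ht), norm_mul]; ring
    _ ≤ _ := mul_le_mul_of_nonneg_left (hM t (Metric.sphere_subset_closedBall ht)) (by positivity)

/-- Geometry of the disc around the segment. -/
lemma pade_geom (a b c d : ℝ) (hab : a ≤ b) (hcd : c ≤ d) (hseg : Set.Icc c d ∩ Set.Icc a b = ∅) :
    ∃ (x0 e : ℂ) (ρ δ θ r σ : ℝ), 0 < ρ ∧ 0 < δ ∧ 0 ≤ θ ∧ θ < 1 ∧ 0 < r ∧
      Metric.closedBall x0 ρ ⊆ padeU a b ∧ Metric.ball e r ⊆ Metric.closedBall x0 ρ ∧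
      (∀ y ∈ Set.Icc c d, (y : ℂ) ∈ Metric.closedBall x0 ρ ∧ (∀ t ∈ Metric.sphere x0 ρ, δ ≤ ‖t - y‖) ∧
        ∀ t ∈ Metric.sphere x0 ρ, ∀ z ∈ Metric.ball e r, ‖z - y‖ ≤ θ * ‖t - y‖) ∧
      |σ| = 1 ∧ ∀ y ∈ Set.Icc c d, ∀ x ∈ Set.Icc a b, δ ≤ σ * (x - y) := by
  have hab' : b < c ∨ d < a := by
    by_contra h
    push Not at h
    have : max a c ∈ Set.Icc c d ∩ Set.Icc a b :=
      ⟨⟨le_max_right _ _, max_le h.2 hcd⟩, ⟨le_max_left _ _, max_le hab h.1⟩⟩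
    rw [hseg] at this; exact this
  have main : ∀ (x0 e δ ρ : ℝ), 0 < δ → 0 < ρ → (∀ y ∈ Set.Icc c d, |y - e| + |y - x0| ≤ ρ - 2 * δ) → 
      (∀ x ∈ Set.Icc a b, ρ < |x - x0|) → |e - x0| ≤ ρ - 2 * δ → 
      ∃ θ : ℝ, 0 ≤ θ ∧ θ < 1 ∧ Metric.closedBall (x0:ℂ) ρ ⊆ padeU a b ∧
        Metric.ball (e:ℂ) δ ⊆ Metric.closedBall (x0:ℂ) ρ ∧
      (∀ y ∈ Set.Icc c d, (y : ℂ) ∈ Metric.closedBall (x0:ℂ) ρ ∧ (∀ t ∈ Metric.sphere (x0:ℂ) ρ, δ ≤ ‖t - y‖) ∧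
        ∀ t ∈ Metric.sphere (x0:ℂ) ρ, ∀ z ∈ Metric.ball (e:ℂ) δ, ‖z - y‖ ≤ θ * ‖t - y‖) := by
    intro x0 e δ ρ hδ hρ hy hx he
    have hδρ : 2 * δ ≤ ρ := by linarith [abs_nonneg (e - x0)]
    have hn : ∀ u v : ℝ, ‖(u:ℂ) - v‖ = |u - v| := by
      intro u v; rw [← Complex.ofReal_sub, Complex.norm_real, Real.norm_eq_abs]
    refine ⟨1 - δ / ρ, ?_, ?_, ?_, ?_, ?_⟩
    · rw [sub_nonneg, div_le_one hρ]; linarith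
    · linarith [div_pos hδ hρ]
    · intro z hz x hx' hzx
      rw [hzx, mem_closedBall_iff_norm, hn] at hz
      linarith [hx x hx']
    · intro z hz
      rw [mem_ball_iff_norm] at hz
      rw [mem_closedBall_iff_norm]
      have := norm_sub_le_norm_sub_add_norm_sub z e x0
      rw [hn] at this
      linarith
    · intro y hy'
      have h1 := hy y hy'
      have h2 : ∀ t ∈ Metric.sphere (x0:ℂ) ρ, |y - e| + 2 * δ ≤ ‖t - y‖ := by
        intro t ht
        rw [mem_sphere_iff_norm] at ht
        have := norm_sub_le_norm_sub_add_norm_sub t y x0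
        rw [hn] at this
        linarith
      refine ⟨?_, ?_, ?_⟩
      · rw [mem_closedBall_iff_norm, hn]; linarith [abs_nonneg (y - e)]
      · intro t ht; linarith [h2 t ht, abs_nonneg (y - e)]
      · intro t ht z hz
        rw [mem_ball_iff_norm] at hz
        have h3 : ‖z - y‖ ≤ δ + |y - e| := by
          have := norm_sub_le_norm_sub_add_norm_sub z e y
          rw [hn, abs_sub_comm] at this
          linarith
        have h4 : |y - e| + 2 * δ ≤ ρ := by linarith [abs_nonneg (y - x0)]
        have h5 : (1 - δ / ρ) * (|y - e| + 2 * δ) ≤ (1 - δ / ρ) * ‖t - y‖ := by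
          apply mul_le_mul_of_nonneg_left (h2 t ht)
          rw [sub_nonneg, div_le_one hρ]; linarith
        have h6 : δ / ρ * (|y - e| + 2 * δ) ≤ δ := by
          rw [div_mul_eq_mul_div, div_le_iff₀ hρ]
          exact mul_le_mul_of_nonneg_left h4 hδ.le
        linarith
  rcases hab' with h | h
  · set δ := (c - b) / 4 with hδ
    have hδ0 : 0 < δ := by rw [hδ]; linarith
    obtain ⟨θ, h1, h2, h3, h4, h5⟩ := main d c δ (d - c + 2 * δ) hδ0 (by linarith)
      (by
        rintro y ⟨hy1, hy2⟩
        rw [abs_of_nonneg (by linarith), abs_of_nonpos (by linarith)]; linarith)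
      (by
        rintro x ⟨hx1, hx2⟩
        rw [abs_of_nonpos (by linarith)]; linarith)
      (by rw [abs_of_nonpos (by linarith)]; linarith)
    refine ⟨d, c, d - c + 2 * δ, δ, θ, δ, -1, by linarith, hδ0, h1, h2, hδ0, h3, h4, h5, by simp, ?_⟩
    rintro y ⟨hy1, hy2⟩ x ⟨hx1, hx2⟩
    linarith
  · set δ := (a - d) / 4 with hδ
    have hδ0 : 0 < δ := by rw [hδ]; linarith
    obtain ⟨θ, h1, h2, h3, h4, h5⟩ := main c d δ (d - c + 2 * δ) hδ0 (by linarith)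
      (by
        rintro y ⟨hy1, hy2⟩
        rw [abs_of_nonpos (by linarith), abs_of_nonneg (by linarith)]; linarith)
      (by
        rintro x ⟨hx1, hx2⟩
        rw [abs_of_nonneg (by linarith)]; linarith)
      (by rw [abs_of_nonneg (by linarith)]; linarith)
    refine ⟨c, d, d - c + 2 * δ, δ, θ, δ, 1, by linarith, hδ0, h1, h2, hδ0, h3, h4, h5, by simp, ?_⟩
    rintro y ⟨hy1, hy2⟩ x ⟨hx1, hx2⟩
    linarith

lemma pade_dist (a b : ℝ) (K : Set ℂ) (hK : IsCompact K) (hKU : K ⊆ padeU a b) :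
    ∃ δ > (0:ℝ), ∀ z ∈ K, ∀ x ∈ Set.Icc a b, δ ≤ ‖z - (x:ℂ)‖ := by
  have hc : IsCompact (K ×ˢ Set.Icc a b) := hK.prod isCompact_Icc
  have hcont : ContinuousOn (fun p : ℂ × ℝ => ‖p.1 - (p.2:ℂ)‖) (K ×ˢ Set.Icc a b) := by fun_prop
  rcases (K ×ˢ Set.Icc a b).eq_empty_or_nonempty with h | h
  · refine ⟨1, one_pos, fun z hz x hx => ?_⟩
    have : (z, x) ∈ K ×ˢ Set.Icc a b := ⟨hz, hx⟩
    rw [h] at this; exact this.elim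
  · obtain ⟨⟨z0, x0⟩, ⟨h1, h2⟩, hmin⟩ := hc.exists_isMinOn h hcont
    refine ⟨‖z0 - (x0:ℂ)‖, ?_, fun z hz x hx => hmin (show (z, x) ∈ K ×ˢ Set.Icc a b from ⟨hz, hx⟩)⟩
    refine norm_pos_iff.2 (sub_ne_zero.2 ?_)
    exact hKU h1 x0 h2

lemma pade_ae (a b : ℝ) (s : Measure ℝ) (hsupp : s ((Set.Icc a b)ᶜ) = 0) :
    ∀ᵐ x ∂s, x ∈ Set.Icc a b := by
  rw [ae_iff]; exact hsupp

lemma pade_int {E : Type*} [NormedAddCommGroup E] (a b : ℝ) (s : Measure ℝ) [IsFiniteMeasure s]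
    (hsupp : s ((Set.Icc a b)ᶜ) = 0) (f : ℝ → E) (hf : ContinuousOn f (Set.Icc a b)) :
    Integrable f s := by
  have := hf.integrableOn_compact (μ := s) isCompact_Icc
  rwa [IntegrableOn, Measure.restrict_eq_self_of_ae_mem (pade_ae a b s hsupp)] at this

lemma pade_ct_cont (a b : ℝ) (u : ℝ → ℂ) (hu : ContinuousOn u (Set.Icc a b)) (z : ℂ) (hz : z ∈ padeU a b) :
    ContinuousOn (fun x : ℝ => u x * (z - (x:ℂ))⁻¹) (Set.Icc a b) := by
  refine hu.mul (ContinuousOn.inv₀ (by fun_prop) fun x hx => sub_ne_zero.2 (hz x hx))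

lemma pade_ct_bound (a b : ℝ) (s : Measure ℝ) [IsFiniteMeasure s]
    (hsupp : s ((Set.Icc a b)ᶜ) = 0) (u : ℝ → ℂ) (hu : ContinuousOn u (Set.Icc a b))
    (z : ℂ) (δ : ℝ) (hδ : 0 < δ) (hz : ∀ x ∈ Set.Icc a b, δ ≤ ‖z - (x:ℂ)‖) :
    ‖∫ x, u x * (z - (x:ℂ))⁻¹ ∂s‖ ≤ (∫ x, ‖u x‖ ∂s) / δ := by
  rw [div_eq_mul_inv, ← integral_mul_const]
  refine norm_integral_le_of_norm_le ((pade_int a b s hsupp u hu).norm.mul_const _) ?_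
  filter_upwards [pade_ae a b s hsupp] with x hx
  rw [norm_mul, norm_inv]
  have := hz x hx
  gcongr

lemma pade_ct_lim (a b : ℝ) (s : Measure ℝ) [IsFiniteMeasure s]
    (hsupp : s ((Set.Icc a b)ᶜ) = 0) (u : ℝ → ℂ) (hu : ContinuousOn u (Set.Icc a b)) :
    Tendsto (fun z : ℂ => ∫ x, u x * (z - (x:ℂ))⁻¹ ∂s) (cocompact ℂ) (nhds 0) := by
  have h1 : Tendsto (fun z : ℂ => ‖z‖ - (|a| + |b|)) (cocompact ℂ) atTop :=
    tendsto_atTop_add_const_right _ _ (tendsto_norm_cocompact_atTop)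
  have h2 : Tendsto (fun z : ℂ => (∫ x, ‖u x‖ ∂s) / (‖z‖ - (|a| + |b|))) (cocompact ℂ) (nhds 0) :=
    h1.const_div_atTop _
  refine squeeze_zero_norm' ?_ h2
  filter_upwards [h1.eventually_gt_atTop 0] with z hz
  refine pade_ct_bound a b s hsupp u hu z _ hz fun x hx => ?_
  have : ‖(x:ℂ)‖ ≤ |a| + |b| := by
    rw [Complex.norm_real, Real.norm_eq_abs, abs_le]
    constructor
    · linarith [hx.1, neg_abs_le a, abs_nonneg b]
    · linarith [hx.2, le_abs_self b, abs_nonneg a]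
  linarith [norm_sub_norm_le z (x:ℂ)]

lemma pade_ct_continuousOn (a b : ℝ) (s : Measure ℝ) [IsFiniteMeasure s]
    (hsupp : s ((Set.Icc a b)ᶜ) = 0) (u : ℝ → ℂ) (hu : ContinuousOn u (Set.Icc a b)) :
    ContinuousOn (fun z : ℂ => ∫ x, u x * (z - (x:ℂ))⁻¹ ∂s) (padeU a b) := by
  intro z0 hz0
  refine ContinuousAt.continuousWithinAt ?_
  obtain ⟨r, hr, hrU⟩ := Metric.nhds_basis_closedBall.mem_iff.1 ((padeU_open a b).mem_nhds hz0)
  obtain ⟨δ, hδ, hd⟩ := pade_dist a b _ (isCompact_closedBall z0 r) hrU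
  have hn : Metric.closedBall z0 r ∈ nhds z0 := Metric.closedBall_mem_nhds z0 hr
  refine continuousAt_of_dominated (bound := fun x => ‖u x‖ * δ⁻¹) ?_ ?_
    ((pade_int a b s hsupp u hu).norm.mul_const _) ?_
  · filter_upwards [hn] with z hz
    exact (pade_int a b s hsupp _ (pade_ct_cont a b u hu z (hrU hz))).aestronglyMeasurable
  · filter_upwards [hn] with z hz
    filter_upwards [pade_ae a b s hsupp] with x hx
    rw [norm_mul, norm_inv]
    have := hd z hz x hx
    gcongr
  · filter_upwards [pade_ae a b s hsupp] with x hx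
    exact continuousAt_const.mul (ContinuousAt.inv₀ (by fun_prop) (sub_ne_zero.2 (hz0 x hx)))

lemma pade_T (s : Measure ℝ) (u : ℝ → ℂ)
    (hu : ∀ Q : ℂ[X], Integrable (fun x : ℝ => Q.eval (x:ℂ) * u x) s) (Q : ℂ[X]) :
    ∃ T : ℂ[X], ∀ (z : ℂ) (D : ℂ[X]), (X - C z) * D = Q - C (Q.eval z) →
      T.eval z = ∫ x, D.eval (x:ℂ) * u x ∂s := by
  have hex : ∀ (Q : ℂ[X]) (z : ℂ), ∃ D, (X - C z) * D = Q - C (Q.eval z) := by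
    intro Q z
    obtain ⟨D, hD⟩ : X - C z ∣ Q - C (Q.eval z) := X_sub_C_dvd_sub_C_eval
    exact ⟨D, hD.symm⟩
  have hun : ∀ (Q : ℂ[X]) (z : ℂ) (D D' : ℂ[X]), (X - C z) * D = Q → (X - C z) * D' = Q → D = D' := by
    intro Q z D D' h h'
    exact mul_left_cancel₀ (X_sub_C_ne_zero z) (h.trans h'.symm)
  have hX : ∀ Q : ℂ[X], (∃ T : ℂ[X], ∀ (z : ℂ) (D : ℂ[X]), (X - C z) * D = Q - C (Q.eval z) →
      T.eval z = ∫ x, D.eval (x:ℂ) * u x ∂s) → (∃ T : ℂ[X], ∀ (z : ℂ) (D : ℂ[X]), (X - C z) * D = (Q * X) - C ((Q * X).eval z) →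
      T.eval z = ∫ x, D.eval (x:ℂ) * u x ∂s) := by
    rintro Q ⟨T, hT⟩
    refine ⟨T * X + C (∫ x, Q.eval (x:ℂ) * u x ∂s), fun z D hD => ?_⟩
    obtain ⟨D1, h1⟩ := hex Q z
    have : D = C z * D1 + Q := by
      apply hun _ z _ _ hD
      simp only [eval_mul, eval_X, C_mul]
      linear_combination C z * h1
    rw [this]
    simp only [eval_add, eval_mul, eval_X, eval_C]
    rw [hT z D1 h1]
    have e : ∀ x : ℝ, (z * D1.eval (x:ℂ) + Q.eval (x:ℂ)) * u x = z * (D1.eval (x:ℂ) * u x) + Q.eval (x:ℂ) * u x := by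
      intro x; ring
    simp_rw [e]
    rw [integral_add ((hu D1).const_mul z) (hu Q), integral_const_mul]
    ring
  induction Q using Polynomial.induction_on with
  | C r =>
    refine ⟨0, fun z D hD => ?_⟩
    have : D = 0 := hun _ z _ _ hD (by simp)
    simp [this]
  | add P Q hP hQ =>
    obtain ⟨T1, h1⟩ := hP
    obtain ⟨T2, h2⟩ := hQ
    refine ⟨T1 + T2, fun z D hD => ?_⟩
    obtain ⟨D1, hD1⟩ := hex P z
    obtain ⟨D2, hD2⟩ := hex Q z
    have : D = D1 + D2 := by
      apply hun _ z _ _ hD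
      simp only [eval_add, C_add]
      linear_combination hD1 + hD2
    rw [this]
    simp only [eval_add, add_mul]
    rw [integral_add (hu D1) (hu D2), h1 z D1 hD1, h2 z D2 hD2]
  | monomial n r ih =>
    have := hX _ ih
    rwa [mul_assoc, ← pow_succ] at this

lemma pade_div (U : Set ℂ) (hU : IsOpen U) (E : ℂ → ℂ) (hE : ContinuousOn E U) :
    ∀ (k : ℕ) (W T : ℂ[X]) (A : Set ℂ), A.Finite → W ≠ 0 → W.natDegree = k → (∀ ζ, W.eval ζ = 0 → ζ ∈ U) →
      (∀ z ∈ U, z ∉ A → T.eval z = W.eval z * E z) → W ∣ T := by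
  intro k
  induction k with
  | zero =>
    intro W T A hA hW hk _ _
    rw [eq_C_of_natDegree_eq_zero hk] at hW ⊢
    have : W.coeff 0 ≠ 0 := by simpa using hW
    exact (isUnit_C.2 this.isUnit).dvd
  | succ k ih =>
    intro W T A hA hW hk hr hT
    obtain ⟨ζ, hζ⟩ := IsAlgClosed.exists_root W (by
      rw [degree_eq_natDegree hW, hk]; exact_mod_cast Nat.succ_ne_zero k)
    have hζU : ζ ∈ U := hr ζ hζ
    have hT0 : T.eval ζ = 0 := by
      have h1 : Tendsto (fun z => T.eval z) (nhdsWithin ζ {ζ}ᶜ) (nhds (T.eval ζ)) :=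
        (T.continuous.tendsto ζ).mono_left nhdsWithin_le_nhds
      have h2 : Tendsto (fun z => W.eval z * E z) (nhdsWithin ζ {ζ}ᶜ) (nhds (W.eval ζ * E ζ)) :=
        ((W.continuous.continuousAt.mul (hE.continuousAt (hU.mem_nhds hζU))).tendsto).mono_left nhdsWithin_le_nhds
      rw [show W.eval ζ = 0 from hζ, zero_mul] at h2
      refine tendsto_nhds_unique (h1.congr' ?_) h2
      have hA' : (A \ {ζ})ᶜ ∈ nhds ζ := (hA.subset Set.sdiff_subset).isClosed.isOpen_compl.mem_nhds (by simp)
      filter_upwards [mem_nhdsWithin_of_mem_nhds (hU.mem_nhds hζU), self_mem_nhdsWithin,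
        mem_nhdsWithin_of_mem_nhds hA'] with z hz hz1 hz2
      exact hT z hz fun hzA => hz2 ⟨hzA, hz1⟩
    obtain ⟨W', rfl⟩ := dvd_iff_isRoot.2 hζ
    obtain ⟨T', rfl⟩ := dvd_iff_isRoot.2 hT0
    have hW' : W' ≠ 0 := right_ne_zero_of_mul hW
    rw [natDegree_mul (X_sub_C_ne_zero ζ) hW', natDegree_X_sub_C] at hk
    refine mul_dvd_mul_left _ ?_
    refine ih W' T' (insert ζ A) (hA.insert ζ) hW' (by omega) (fun ξ hξ => hr ξ (by simp [hξ])) ?_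
    intro z hz hzA
    simp only [Set.mem_insert_iff, not_or] at hzA
    have := hT z hz hzA.2
    simp only [eval_mul, mul_assoc] at this
    refine mul_left_cancel₀ ?_ this
    simp [sub_ne_zero, hzA.1]

lemma pade_T_zero (a b : ℝ) (E : ℂ → ℂ) (hE : ContinuousOn E (padeU a b))
    (hlim : Tendsto E (cocompact ℂ) (nhds 0)) (W T : ℂ[X]) (hW : W ≠ 0)
    (hr : ∀ ζ, W.eval ζ = 0 → ζ ∈ padeU a b)
    (hT : ∀ z ∈ padeU a b, W.eval z ≠ 0 → T.eval z = W.eval z * E z) : T = 0 := by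
  set A : Set ℂ := {z | W.eval z = 0} with hA
  have hAf : A.Finite := by
    have : A = (W.rootSet ℂ) := by
      ext z; simp [hA, mem_rootSet, hW]
    rw [this]; exact W.rootSet_finite ℂ
  obtain ⟨S, rfl⟩ := pade_div (padeU a b) (padeU_open a b) E hE W.natDegree W T A hAf hW rfl hr
    (fun z hz hzA => hT z hz hzA)
  have hS : Tendsto (fun z => S.eval z) (cocompact ℂ) (nhds 0) := by
    refine hlim.congr' ?_
    have h1 : Aᶜ ∈ cocompact ℂ := hAf.isCompact.compl_mem_cocompact
    have h2 : padeU a b ∈ cocompact ℂ := by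
      rw [padeU_eq]; exact (isCompact_Icc.image Complex.continuous_ofReal).compl_mem_cocompact
    filter_upwards [h1, h2] with z hz1 hz2
    have := hT z hz2 hz1
    rw [eval_mul] at this
    exact (mul_left_cancel₀ hz1 this).symm
  have : S = 0 := by
    apply Polynomial.funext
    intro z
    rw [S.differentiable.apply_eq_of_tendsto_cocompact z hS]; simp
  rw [this, mul_zero]

lemma pade_C (a b : ℝ) (s : Measure ℝ) [IsFiniteMeasure s]
    (hsupp : s ((Set.Icc a b)ᶜ) = 0) (q p w : ℝ[X]) (F : ℂ → ℂ) (hw0 : w ≠ 0)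
    (hwr : ∀ z : ℂ, aeval z w = 0 → z ∈ padeU a b)
    (hF : ContinuousOn F (padeU a b))
    (hFeq : ∀ z ∈ padeU a b, aeval z w ≠ 0 →
        F z = (aeval z q * cauchy s z - aeval z p) / aeval z w)
    (hlim : Tendsto F (cocompact ℂ) (nhds 0)) :
    (∀ z ∈ padeU a b, aeval z q * cauchy s z - aeval z p =
      aeval z w * ∫ x, ((q.eval x / w.eval x : ℝ) : ℂ) * (z - (x:ℂ))⁻¹ ∂s) ∧
    (∀ (y : ℝ) (D : ℝ[X]), q = (X - C y) * D →
      p.eval y = w.eval y * ∫ x, D.eval x / w.eval x ∂s) := by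
  have hwx : ∀ x ∈ Set.Icc a b, w.eval x ≠ 0 := by
    intro x hx h
    have : aeval (x:ℂ) w = 0 := by
      have := aeval_algebraMap_apply ℂ x w
      simp only [Complex.coe_algebraMap] at this
      rw [this]; simp [h]
    exact hwr x this x hx rfl
  have hev : ∀ (P : ℝ[X]) (x : ℝ), (P.map (algebraMap ℝ ℂ)).eval (x:ℂ) = ((P.eval x : ℝ) : ℂ) := by
    intro P x
    have := eval_map_apply (f := algebraMap ℝ ℂ) (p := P) x
    simpa using this
  have hevz : ∀ (P : ℝ[X]) (z : ℂ), (P.map (algebraMap ℝ ℂ)).eval z = aeval z P := by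
    intro P z; rw [eval_map_algebraMap]
  set u : ℝ → ℂ := fun x => ((q.eval x / w.eval x : ℝ) : ℂ) with hu
  have huc : ContinuousOn u (Set.Icc a b) := by
    refine Complex.continuous_ofReal.comp_continuousOn ?_
    exact q.continuous.continuousOn.div w.continuous.continuousOn hwx
  have hi1 : ∀ Q : ℂ[X], Integrable (fun x : ℝ => Q.eval (x:ℂ) * (fun _ => (1:ℂ)) x) s := fun Q =>
    pade_int a b s hsupp _ (((Q.continuous.comp Complex.continuous_ofReal).mul continuous_const).continuousOn)
  have hi2 : ∀ Q : ℂ[X], Integrable (fun x : ℝ => Q.eval (x:ℂ) * u x) s := fun Q =>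
    pade_int a b s hsupp _ ((Q.continuous.comp Complex.continuous_ofReal).continuousOn.mul huc)
  obtain ⟨T1, hT1⟩ := pade_T s _ hi1 (q.map (algebraMap ℝ ℂ))
  obtain ⟨T2, hT2⟩ := pade_T s u hi2 (w.map (algebraMap ℝ ℂ))
  set Ft : ℂ → ℂ := fun z => ∫ x, u x * (z - (x:ℂ))⁻¹ ∂s with hFt
  have hTz : ∀ z ∈ padeU a b, (T1 - T2 - p.map (algebraMap ℝ ℂ)).eval z =
      aeval z q * cauchy s z - aeval z p - aeval z w * Ft z := by
    intro z hz
    obtain ⟨D1, hD1⟩ : X - C z ∣ q.map (algebraMap ℝ ℂ) - C ((q.map (algebraMap ℝ ℂ)).eval z) := X_sub_C_dvd_sub_C_eval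
    obtain ⟨D2, hD2⟩ : X - C z ∣ w.map (algebraMap ℝ ℂ) - C ((w.map (algebraMap ℝ ℂ)).eval z) := X_sub_C_dvd_sub_C_eval
    have hqc : ContinuousOn (fun x : ℝ => ((q.eval x : ℝ) : ℂ)) (Set.Icc a b) :=
      (Complex.continuous_ofReal.comp q.continuous).continuousOn
    have I1 := pade_int a b s hsupp _ (pade_ct_cont a b (fun _ => 1) continuousOn_const z hz)
    have I2 := pade_int a b s hsupp _ (pade_ct_cont a b _ hqc z hz)
    have I3 := pade_int a b s hsupp _ (pade_ct_cont a b _ huc z hz)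
    have e1 : T1.eval z = aeval z q * cauchy s z - ∫ x, ((q.eval x : ℝ) : ℂ) * (z - (x:ℂ))⁻¹ ∂s := by
      rw [hT1 z D1 hD1.symm, cauchy, ← integral_const_mul, ← integral_sub]
      · refine integral_congr_ae ?_
        filter_upwards [pade_ae a b s hsupp] with x hx
        have h0 : z - (x:ℂ) ≠ 0 := sub_ne_zero.2 (hz x hx)
        have h1 := congrArg (eval (x:ℂ)) hD1
        simp only [eval_sub, eval_mul, eval_X, eval_C, hev, hevz] at h1
        field_simp
        linear_combination h1
      · simpa using I1.const_mul (aeval z q)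
      · exact I2
    have e2 : T2.eval z = aeval z w * Ft z - ∫ x, ((q.eval x : ℝ) : ℂ) * (z - (x:ℂ))⁻¹ ∂s := by
      rw [hT2 z D2 hD2.symm, hFt]
      simp only
      rw [← integral_const_mul, ← integral_sub]
      · refine integral_congr_ae ?_
        filter_upwards [pade_ae a b s hsupp] with x hx
        have h0 : z - (x:ℂ) ≠ 0 := sub_ne_zero.2 (hz x hx)
        have h1 := congrArg (eval (x:ℂ)) hD2
        simp only [eval_sub, eval_mul, eval_X, eval_C, hev, hevz] at h1
        have h2 : ((w.eval x : ℝ) : ℂ) ≠ 0 := by exact_mod_cast hwx x hx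
        simp only [hu, Complex.ofReal_div]
        field_simp
        linear_combination ((q.eval x : ℝ) : ℂ) * h1
      · exact I3.const_mul _
      · exact I2
    rw [eval_sub, eval_sub, e1, e2, hevz]
    ring
  have hT0 : T1 - T2 - p.map (algebraMap ℝ ℂ) = 0 := by
    refine pade_T_zero a b (fun z => F z - Ft z) (hF.sub (pade_ct_continuousOn a b s hsupp u huc)) ?_
      (w.map (algebraMap ℝ ℂ)) _ ?_ ?_ ?_
    · simpa using hlim.sub (pade_ct_lim a b s hsupp u huc)
    · exact (Polynomial.map_ne_zero_iff (algebraMap ℝ ℂ).injective).2 hw0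
    · intro ζ hζ; rw [hevz] at hζ; exact hwr ζ hζ
    · intro z hz hwz
      rw [hevz] at hwz ⊢
      rw [hTz z hz, hFeq z hz hwz]
      field_simp
  constructor
  · intro z hz
    have := hTz z hz
    rw [hT0, eval_zero] at this
    linear_combination -this
  · intro y D hD
    have h1 := congrArg (eval (y:ℂ)) hT0
    rw [eval_sub, eval_sub, eval_zero, hev] at h1
    obtain ⟨D2, hD2⟩ : X - C y ∣ w - C (w.eval y) := X_sub_C_dvd_sub_C_eval
    have hq : (X - C (y:ℂ)) * D.map (algebraMap ℝ ℂ) = q.map (algebraMap ℝ ℂ) - C ((q.map (algebraMap ℝ ℂ)).eval (y:ℂ)) := by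
      rw [hev, hD]; simp
    have hw : (X - C (y:ℂ)) * D2.map (algebraMap ℝ ℂ) = w.map (algebraMap ℝ ℂ) - C ((w.map (algebraMap ℝ ℂ)).eval (y:ℂ)) := by
      have := congrArg (Polynomial.map (algebraMap ℝ ℂ)) hD2
      simp only [Polynomial.map_sub, Polynomial.map_mul, map_C, map_X, Complex.coe_algebraMap] at this
      rw [hev]; exact this.symm
    rw [hT1 _ _ hq, hT2 _ _ hw] at h1
    simp only [hev, hu, mul_one, ← Complex.ofReal_mul] at h1
    rw [integral_complex_ofReal, integral_complex_ofReal] at h1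
    have h2 : p.eval y = ∫ x, D.eval x ∂s - ∫ x, D2.eval x * (q.eval x / w.eval x) ∂s := by
      have : ((p.eval y : ℝ) : ℂ) = ((∫ x, D.eval x ∂s - ∫ x, D2.eval x * (q.eval x / w.eval x) ∂s : ℝ) : ℂ) := by
        push_cast
        linear_combination -h1
      exact_mod_cast this
    rw [h2, ← integral_const_mul, ← integral_sub]
    · refine integral_congr_ae ?_
      filter_upwards [pade_ae a b s hsupp] with x hx
      have h3 := congrArg (eval x) hD2
      simp only [eval_sub, eval_mul, eval_X, eval_C] at h3
      have h4 := congrArg (eval x) hD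
      simp only [eval_sub, eval_mul, eval_X, eval_C] at h4
      have h5 := hwx x hx
      rw [h4]
      field_simp
      linear_combination D.eval x * h3
    · exact pade_int a b s hsupp _ D.continuous.continuousOn
    · exact pade_int a b s hsupp _ (D2.continuous.continuousOn.mul
        (q.continuous.continuousOn.div w.continuous.continuousOn hwx))

/-- orthogonality relations -/
lemma pade_orth (a b : ℝ) (hab : a ≤ b) (s : Measure ℝ) [IsFiniteMeasure s]
    (hsupp : s ((Set.Icc a b)ᶜ) = 0) (q p w : ℝ[X]) (F : ℂ → ℂ) (hw0 : w ≠ 0)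
    (hwr : ∀ z : ℂ, aeval z w = 0 → z ∈ padeU a b)
    (hF : ContinuousOn F (padeU a b))
    (hFeq : ∀ z ∈ padeU a b, aeval z w ≠ 0 →
        F z = (aeval z q * cauchy s z - aeval z p) / aeval z w)
    (m : ℕ) (hlim : ∀ k ≤ m, Tendsto (fun z => z ^ k * F z) (cocompact ℂ) (nhds 0)) :
    ∀ k < m, ∫ x, (q * X ^ k).eval x / w.eval x ∂s = 0 := by
  intro k hk
  have hlim' : Tendsto (fun z => aeval z ((X - C a) * X ^ k : ℝ[X]) * F z) (cocompact ℂ) (nhds 0) := by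
    have := (hlim (k+1) hk).sub ((hlim k hk.le).const_mul (a:ℂ))
    simp only [mul_zero, sub_zero] at this
    refine this.congr fun z => ?_
    simp
    ring
  have := (pade_C a b s hsupp (q * ((X - C a) * X ^ k)) (p * ((X - C a) * X ^ k)) w
    (fun z => aeval z ((X - C a) * X ^ k : ℝ[X]) * F z) hw0 hwr
    ((((X - C a) * X ^ k : ℝ[X]).continuous_aeval.continuousOn).mul hF) (by
      intro z hz hwz
      simp only [hFeq z hz hwz, map_mul]
      ring) hlim').2
  have h1 := this a (q * X ^ k) (by ring)
  have h2 : w.eval a ≠ 0 := by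
    intro h
    have h3 : aeval (a:ℂ) w = 0 := by
      have := aeval_algebraMap_apply ℂ a w
      simp only [Complex.coe_algebraMap] at this
      rw [this]; simp [h]
    exact hwr a h3 a ⟨le_rfl, hab⟩ rfl
  simp at h1
  rcases h1 with h1 | h1
  · exact absurd h1 h2
  · simpa using h1

lemma pade_quad (Λ : ℝ[X] →ₗ[ℝ] ℝ) (S : Finset ℝ) (g : ℝ[X]) (m : ℕ)
    (horth : ∀ h : ℝ[X], h.degree < m → Λ (Lagrange.nodal S id * g * h) = 0)
    (hpos : ∀ H : ℝ[X], H ≠ 0 → 0 < Λ (g * H ^ 2)) :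
    ∃ (I : Finset ℝ) (lam : ℝ → ℝ), I ⊆ S ∧ 2 * I.card + m ≤ S.card ∧
      (∀ i ∈ S \ I, 0 ≤ lam i) ∧
      (∀ H : ℝ[X], H.degree < (S.card + m : ℕ) → Λ (g * H) = ∑ i ∈ S, lam i * H.eval i) ∧
      ∀ i ∈ S, Λ (Lagrange.nodal (S.erase i) id * g) = lam i * (Lagrange.nodal (S.erase i) id).eval i := by
  set N : ℝ[X] := Lagrange.nodal S id with hN
  have hNm : N.Monic := Lagrange.nodal_monic
  have hNd : N.natDegree = S.card := Lagrange.natDegree_nodal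
  have hNdeg : N.degree = S.card := Lagrange.degree_nodal
  set lam : ℝ → ℝ := fun i => Λ (g * Lagrange.basis S id i) with hlam
  have hexact : ∀ H : ℝ[X], H.degree < (S.card + m : ℕ) → Λ (g * H) = ∑ i ∈ S, lam i * H.eval i := by
    intro H hH
    have h1 : H %ₘ N = Lagrange.interpolate S id (fun i => H.eval i) := by
      refine Lagrange.eq_interpolate_of_eval_eq _ (Set.injOn_id _) ?_ ?_
      · rw [← hNdeg]; exact degree_modByMonic_lt _ hNm
      · intro i hi
        have := congrArg (eval i) (modByMonic_add_div H N)
        rw [eval_add, eval_mul, show N.eval i = 0 from Lagrange.eval_nodal_at_node (v := id) hi] at this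
        simpa using this
    have h2 : Λ (N * g * (H /ₘ N)) = 0 := by
      apply horth
      by_cases h0 : H /ₘ N = 0
      · rw [h0, degree_zero]; exact WithBot.bot_lt_coe m
      have hH0 : H ≠ 0 := by rintro rfl; simp at h0
      rw [← natDegree_lt_iff_degree_lt h0, natDegree_divByMonic _ hNm, hNd]
      rw [← natDegree_lt_iff_degree_lt hH0] at hH
      have : ¬ H.degree < N.degree := fun h => h0 ((divByMonic_eq_zero_iff hNm).2 h)
      rw [not_lt, hNdeg, degree_eq_natDegree hH0] at this
      have : S.card ≤ H.natDegree := by exact_mod_cast this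
      omega
    have h3 : g * H = g * (H %ₘ N) + N * g * (H /ₘ N) := by
      conv_lhs => rw [← modByMonic_add_div H N]
      ring
    rw [h3, map_add, h2, add_zero, h1, Lagrange.interpolate_apply, Finset.mul_sum, map_sum]
    refine Finset.sum_congr rfl fun i _ => ?_
    rw [mul_left_comm, ← smul_eq_C_mul, map_smul, smul_eq_mul, mul_comm]
  refine ⟨S.filter (fun i => lam i < 0), lam, Finset.filter_subset _ _, ?_, ?_, hexact, ?_⟩
  · by_contra hc
    push Not at hc
    set I := S.filter (fun i => lam i < 0) with hI
    have hIS : I ⊆ S := Finset.filter_subset _ _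
    have hcard := Finset.card_sdiff_add_card_eq_card hIS
    have h1 := hpos (Lagrange.nodal (S \ I) id) Lagrange.nodal_ne_zero
    rw [hexact] at h1
    · refine absurd h1 (not_lt.2 (Finset.sum_nonpos fun i hi => ?_))
      by_cases hiI : i ∈ I
      · have : lam i < 0 := (Finset.mem_filter.1 hiI).2
        rw [eval_pow]
        exact mul_nonpos_of_nonpos_of_nonneg this.le (sq_nonneg _)
      · have : (Lagrange.nodal (S \ I) id).eval i = 0 :=
          Lagrange.eval_nodal_at_node (v := id) (Finset.mem_sdiff.2 ⟨hi, hiI⟩)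
        simp [this]
    · rw [degree_pow, Lagrange.degree_nodal]
      have : 2 * (S \ I).card < S.card + m := by omega
      rw [nsmul_eq_mul]
      exact_mod_cast this
  · intro i hi
    simp only [Finset.mem_sdiff, Finset.mem_filter, not_and, not_lt] at hi
    exact hi.2 hi.1
  · intro i hi
    rw [mul_comm, hexact]
    · rw [Finset.sum_eq_single i]
      · intro j hj hji
        rw [show (Lagrange.nodal (S.erase i) id).eval j = 0 from
          Lagrange.eval_nodal_at_node (v := id) (Finset.mem_erase.2 ⟨hji, hj⟩), mul_zero]
      · intro h; exact absurd hi h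
    · rw [Lagrange.degree_nodal]
      have := Finset.card_erase_lt_of_mem hi
      have : (S.erase i).card < S.card + m := by omega
      exact_mod_cast this

lemma pade_core (a b : ℝ) (s : Measure ℝ) [IsFiniteMeasure s]
    (hsupp : s ((Set.Icc a b)ᶜ) = 0)
    (hinf : ∀ F : Finset ℝ, s ((↑F : Set ℝ))ᶜ ≠ 0)
    (q p w : ℝ[X]) (S : Finset ℝ) (g : ℝ[X]) (hS : ∀ x ∈ S, x ∈ Set.Icc a b)
    (hq0 : q ≠ 0) (hq : q = Lagrange.nodal S id * g) (hg : ∀ x ∈ Set.Icc a b, 0 ≤ g.eval x)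
    (hw : ∀ x ∈ Set.Icc a b, 0 < w.eval x) (n m l k : ℕ) (hn : n = m + l)
    (hqd : q.natDegree ≤ n) (hpd : p.degree < (n + k : ℕ)) (hwd : w.natDegree ≤ 2 * n + k)
    (horth : ∀ j < m, ∫ x, (q * X ^ j).eval x / w.eval x ∂s = 0)
    (hp : ∀ (y : ℝ) (D : ℝ[X]), q = (X - C y) * D →
      p.eval y = w.eval y * ∫ x, D.eval x / w.eval x ∂s)
    (w1 w2 : ℝ[X]) (hw12 : w = w1 * w2) (hw0 : w ≠ 0) (hw2d : w2.natDegree = 2 * l + k + 1)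
    (lo hi : ℝ) (hlo : 0 < lo) (hw2 : ∀ x ∈ Set.Icc a b, lo ≤ w2.eval x ∧ w2.eval x ≤ hi) :
    ∃ (G r P : ℝ[X]) (J : Finset ℝ) (A : ℝ → ℝ), G ≠ 0 ∧ G.natDegree ≤ l ∧
      (∀ x ∈ J, x ∈ Set.Icc a b) ∧ q * r = Lagrange.nodal J id * G ∧ P.degree < (l + k : ℕ) ∧
      p * r = Lagrange.nodal J id * P + ∑ i ∈ J, C (A i) * Lagrange.nodal (J.erase i) id ∧
      (∀ i ∈ J, 0 ≤ A i) ∧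
      ∀ B, (∀ x ∈ Set.Icc a b, |G.eval x| ≤ B) → ∑ i ∈ J, A i ≤ hi / lo * B * s.real Set.univ := by
  have hcw : ∀ H : ℝ[X], ContinuousOn (fun x => H.eval x / w.eval x) (Set.Icc a b) := fun H =>
    H.continuous.continuousOn.div w.continuous.continuousOn fun x hx => (hw x hx).ne'
  have hint : ∀ H : ℝ[X], Integrable (fun x => H.eval x / w.eval x) s := fun H =>
    pade_int a b s hsupp _ (hcw H)
  have hg0 : g ≠ 0 := by rintro rfl; simp at hq; exact hq0 hq
  obtain ⟨Λ, hΛ⟩ : ∃ Λ : ℝ[X] →ₗ[ℝ] ℝ, ∀ H, Λ H = ∫ x, H.eval x / w.eval x ∂s := by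
    refine ⟨{ toFun := fun H => ∫ x, H.eval x / w.eval x ∂s, map_add' := ?_, map_smul' := ?_ }, fun H => rfl⟩
    · intro H1 H2
      simp only [eval_add, add_div]
      exact integral_add (hint H1) (hint H2)
    · intro c H
      simp only [eval_smul, smul_eq_mul, mul_div_assoc, RingHom.id_apply]
      exact integral_const_mul _ _
  have horth' : ∀ h : ℝ[X], h.degree < m → Λ (Lagrange.nodal S id * g * h) = 0 := by
    intro h hh
    rw [← hq]
    by_cases h0 : h = 0
    · simp [h0]
    rw [← natDegree_lt_iff_degree_lt h0] at hh
    rw [h.as_sum_range' m hh, Finset.mul_sum, map_sum]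
    refine Finset.sum_eq_zero fun j hj => ?_
    rw [← C_mul_X_pow_eq_monomial, mul_left_comm, ← smul_eq_C_mul, map_smul, hΛ,
      horth j (Finset.mem_range.1 hj), smul_zero]
  have hpos : ∀ H : ℝ[X], H ≠ 0 → 0 < Λ (g * H ^ 2) := by
    intro H hH
    rw [hΛ]
    have hnn : 0 ≤ᵐ[s] fun x => (g * H ^ 2).eval x / w.eval x := by
      filter_upwards [pade_ae a b s hsupp] with x hx
      have h1 := hg x hx
      have h2 := hw x hx
      simp only [eval_mul, eval_pow, Pi.zero_apply]
      positivity
    refine lt_of_le_of_ne (integral_nonneg_of_ae hnn) fun h => ?_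
    rw [eq_comm, integral_eq_zero_iff_of_nonneg_ae hnn (hint _)] at h
    refine hinf (g * H ^ 2).roots.toFinset ?_
    have : ∀ᵐ x ∂s, x ∈ ((g * H ^ 2).roots.toFinset : Set ℝ) := by
      filter_upwards [h, pade_ae a b s hsupp] with x hx hx'
      have h2 := (hw x hx').ne'
      simp only [Pi.zero_apply, div_eq_zero_iff, h2, or_false] at hx
      have h3 : g * H ^ 2 ≠ 0 := mul_ne_zero hg0 (pow_ne_zero 2 hH)
      simp only [Finset.mem_coe, Multiset.mem_toFinset]
      exact (mem_roots h3).2 hx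
    exact ae_iff.1 this
  obtain ⟨I, lam, hIS, hcard, hlam, hexact, hnod⟩ := pade_quad Λ S g m horth' hpos
  set J := S \ I with hJ
  set r : ℝ[X] := Lagrange.nodal I id with hr
  have hJcard : J.card + I.card = S.card := Finset.card_sdiff_add_card_eq_card hIS
  have hNS : ∀ J' I' : Finset ℝ, Disjoint J' I' →
      Lagrange.nodal (J' ∪ I') id = Lagrange.nodal J' id * Lagrange.nodal I' (id : ℝ → ℝ) := by
    intro J' I' h
    rw [Lagrange.nodal_eq, Lagrange.nodal_eq, Lagrange.nodal_eq, Finset.prod_union h]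
  have hSJ : Lagrange.nodal S id = Lagrange.nodal J id * r := by
    rw [hr, ← hNS J I Finset.sdiff_disjoint, hJ, Finset.sdiff_union_of_subset hIS]
  have hr0 : r ≠ 0 := Lagrange.nodal_ne_zero
  have hrd : r.natDegree = I.card := Lagrange.natDegree_nodal
  have hgd : g.natDegree + S.card ≤ n := by
    have : q.natDegree = S.card + g.natDegree := by
      rw [hq, natDegree_mul Lagrange.nodal_ne_zero hg0, Lagrange.natDegree_nodal]
    omega
  set Q : ℝ[X] := Lagrange.nodal J id with hQ
  have hQm : Q.Monic := Lagrange.nodal_monic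
  have hQd : Q.natDegree = J.card := Lagrange.natDegree_nodal
  have hQdeg : Q.degree = J.card := Lagrange.degree_nodal
  have hJS : ∀ i ∈ J, i ∈ S ∧ i ∉ I := fun i hi => Finset.mem_sdiff.1 hi
  set A : ℝ → ℝ := fun i => w.eval i * lam i * (r.eval i) ^ 2 with hA
  have hmod : (p * r) %ₘ Q = ∑ i ∈ J, C (A i) * Lagrange.nodal (J.erase i) id := by
    refine Polynomial.eq_of_degrees_lt_of_eval_index_eq (s := J) (v := id) (Set.injOn_id _) ?_ ?_ ?_
    · rw [← hQdeg]; exact degree_modByMonic_lt _ hQm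
    · refine lt_of_le_of_lt (degree_sum_le _ _) ?_
      rw [Finset.sup_lt_iff (WithBot.bot_lt_coe _)]
      intro i hi
      rw [← smul_eq_C_mul]
      refine lt_of_le_of_lt (degree_smul_le _ _) ?_
      rw [Lagrange.degree_nodal]
      exact_mod_cast Finset.card_erase_lt_of_mem hi
    · intro j hj
      simp only [id]
      have h1 := congrArg (eval j) (modByMonic_add_div (p * r) Q)
      rw [eval_add, eval_mul, show Q.eval j = 0 from Lagrange.eval_nodal_at_node (v := id) hj, zero_mul,
        add_zero] at h1
      rw [h1, eval_finsetSum, Finset.sum_eq_single j]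
      · have hjS := (hJS j hj).1
        have hjI := (hJS j hj).2
        have h2 : q = (X - C j) * (Lagrange.nodal (S.erase j) id * g) := by
          rw [hq, Lagrange.nodal_eq_mul_nodal_erase hjS]; simp [mul_assoc]
        have h3 : Lagrange.nodal (S.erase j) id = Lagrange.nodal (J.erase j) id * r := by
          rw [hr, ← hNS]
          · congr 1
            ext x
            simp only [hJ, Finset.mem_erase, Finset.mem_union, Finset.mem_sdiff]
            constructor
            · rintro ⟨h, h'⟩
              by_cases hx : x ∈ I
              · exact Or.inr hx
              · exact Or.inl ⟨h, h', hx⟩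
            · rintro (⟨h, h', _⟩ | h)
              · exact ⟨h, h'⟩
              · exact ⟨fun e => hjI (e ▸ h), hIS h⟩
          · exact Finset.disjoint_of_subset_left (Finset.erase_subset _ _) Finset.sdiff_disjoint
        rw [eval_mul, hp j _ h2, ← hΛ, hnod j hjS, h3, hA]
        simp only [eval_mul, eval_C]
        ring
      · intro i hi hij
        rw [eval_mul, show (Lagrange.nodal (J.erase i) id).eval j = 0 from
          Lagrange.eval_nodal_at_node (v := id) (Finset.mem_erase.2 ⟨hij.symm, hj⟩), mul_zero]
      · intro h; exact absurd hj h
  have hw1pos : ∀ x ∈ Set.Icc a b, 0 < w1.eval x := by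
    intro x hx
    have h1 := hw x hx
    rw [hw12, eval_mul] at h1
    exact pos_of_mul_pos_left h1 (hlo.le.trans (hw2 x hx).1)
  refine ⟨g * r ^ 2, r, (p * r) /ₘ Q, J, A, mul_ne_zero hg0 (pow_ne_zero 2 hr0), ?_, ?_, ?_, ?_, ?_, ?_, ?_⟩
  · rw [natDegree_mul hg0 (pow_ne_zero 2 hr0), natDegree_pow, hrd]
    omega
  · intro x hx; exact hS x (hJS x hx).1
  · rw [hq, hSJ]; ring
  · by_cases h0 : (p * r) /ₘ Q = 0
    · rw [h0, degree_zero]; exact WithBot.bot_lt_coe _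
    have hp0 : p ≠ 0 := by rintro rfl; simp at h0
    rw [← natDegree_lt_iff_degree_lt h0, natDegree_divByMonic _ hQm, hQd, natDegree_mul hp0 hr0, hrd]
    rw [← natDegree_lt_iff_degree_lt hp0] at hpd
    have : ¬ (p * r).degree < Q.degree := fun h => h0 ((divByMonic_eq_zero_iff hQm).2 h)
    rw [not_lt, hQdeg, degree_eq_natDegree (mul_ne_zero hp0 hr0), natDegree_mul hp0 hr0, hrd] at this
    have : J.card ≤ p.natDegree + I.card := by exact_mod_cast this
    omega
  · rw [← hmod, add_comm]; exact (modByMonic_add_div (p * r) Q).symm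
  · intro i hi
    have h1 := hw i (hS i (hJS i hi).1)
    have h2 := hlam i hi
    simp only [hA]; positivity
  · intro B hB
    have h1 : ∑ i ∈ J, A i ≤ hi * ∑ i ∈ J, lam i * (w1 * r ^ 2).eval i := by
      rw [Finset.mul_sum]
      refine Finset.sum_le_sum fun i hi' => ?_
      have hiI := hS i (hJS i hi').1
      have h2 := hlam i hi'
      have h3 := hw1pos i hiI
      simp only [hA, hw12, eval_mul, eval_pow]
      calc _ = w2.eval i * (lam i * (w1.eval i * r.eval i ^ 2)) := by ring
        _ ≤ _ := mul_le_mul_of_nonneg_right (hw2 i hiI).2 (by positivity)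
    have h2 : ∑ i ∈ J, lam i * (w1 * r ^ 2).eval i = ∑ i ∈ S, lam i * (w1 * r ^ 2).eval i := by
      refine Finset.sum_subset Finset.sdiff_subset fun i hiS hiJ => ?_
      have hiI : i ∈ I := by
        by_contra h; exact hiJ (Finset.mem_sdiff.2 ⟨hiS, h⟩)
      have : r.eval i = 0 := Lagrange.eval_nodal_at_node (v := id) hiI
      simp [this]
    have hw10 : w1 ≠ 0 := by rintro rfl; simp at hw12; exact hw0 hw12
    have hw20 : w2 ≠ 0 := by rintro rfl; simp at hw12; exact hw0 hw12
    have h3 : Λ (g * (w1 * r ^ 2)) = ∑ i ∈ S, lam i * (w1 * r ^ 2).eval i := by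
      apply hexact
      rw [← natDegree_lt_iff_degree_lt (mul_ne_zero hw10 (pow_ne_zero 2 hr0)),
        natDegree_mul hw10 (pow_ne_zero 2 hr0), natDegree_pow, hrd]
      have : w.natDegree = w1.natDegree + w2.natDegree := by rw [hw12, natDegree_mul hw10 hw20]
      omega
    have h4 : Λ (g * (w1 * r ^ 2)) ≤ B / lo * s.real Set.univ := by
      rw [hΛ]
      have : ∀ᵐ x ∂s, (g * (w1 * r ^ 2)).eval x / w.eval x ≤ B / lo := by
        filter_upwards [pade_ae a b s hsupp] with x hx
        have h5 := hw1pos x hx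
        have h6 := (hw2 x hx).1
        have h7 := hB x hx
        have h8 : 0 < w2.eval x := hlo.trans_le h6
        have e : (g * (w1 * r ^ 2)).eval x / w.eval x = (g * r ^ 2).eval x / w2.eval x := by
          rw [hw12]; simp only [eval_mul]; field_simp
        rw [e]
        calc _ ≤ B / w2.eval x := by
              gcongr; exact (le_abs_self _).trans h7
          _ ≤ _ := by
              have : 0 ≤ B := (abs_nonneg _).trans h7
              gcongr
      calc _ ≤ ∫ _, B / lo ∂s := integral_mono_ae (hint _) (integrable_const _) this
        _ = _ := by rw [integral_const, smul_eq_mul, mul_comm]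
    have hhi : 0 ≤ hi ∨ ¬ (Set.Icc a b).Nonempty := by
      by_cases h : (Set.Icc a b).Nonempty
      · obtain ⟨x, hx⟩ := h
        exact Or.inl (hlo.le.trans ((hw2 x hx).1.trans (hw2 x hx).2))
      · exact Or.inr h
    rcases hhi with hhi | hhi
    · calc _ ≤ hi * ∑ i ∈ J, lam i * (w1 * r ^ 2).eval i := h1
        _ ≤ hi * (B / lo * s.real Set.univ) := by
            rw [h2, ← h3]; exact mul_le_mul_of_nonneg_left h4 hhi
        _ = _ := by ring
    · exfalso
      have : Set.Icc a b = ∅ := Set.not_nonempty_iff_eq_empty.1 hhi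
      rw [this] at hsupp
      exact hinf ∅ (by simpa using hsupp)

lemma pade_step0 (a b : ℝ) (hab : a ≤ b) (s : Measure ℝ) [IsFiniteMeasure s]
    (hsupp : s ((Set.Icc a b)ᶜ) = 0)
    (hinf : ∀ F : Finset ℝ, s ((↑F : Set ℝ))ᶜ ≠ 0)
    (q p w : ℝ[X]) (S : Finset ℝ) (g : ℝ[X]) (hS : ∀ x ∈ S, x ∈ Set.Icc a b)
    (hq0 : q ≠ 0) (hq : q = Lagrange.nodal S id * g) (hg : ∀ x ∈ Set.Icc a b, 0 ≤ g.eval x)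
    (hw : ∀ x ∈ Set.Icc a b, 0 < w.eval x) (n m l k : ℕ) (hn : n = m + l)
    (hqd : q.natDegree ≤ n) (hpd : p.degree < (n + k : ℕ)) (hwd : w.natDegree ≤ 2 * n + k)
    (hw0 : w ≠ 0) (hwr : ∀ z : ℂ, aeval z w = 0 → z ∈ padeU a b)
    (F : ℂ → ℂ) (hF : DifferentiableOn ℂ F (padeU a b))
    (hFeq : ∀ z ∈ padeU a b, aeval z w ≠ 0 →
        F z = (aeval z q * cauchy s z - aeval z p) / aeval z w)
    (hlim : ∀ k ≤ m, Tendsto (fun z => z ^ k * F z) (cocompact ℂ) (nhds 0))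
    (Y : List ℝ) (hY : (Y : Multiset ℝ) ≤ w.roots) (hYc : 2 * l + k + 1 ≤ Y.length)
    (σ δ L : ℝ) (hδ : 0 < δ)
    (hYδ : ∀ y ∈ Y, ∀ x ∈ Set.Icc a b, δ ≤ σ * (x - y) ∧ σ * (x - y) ≤ L) :
    ∃ (M : ℝ) (Z : Multiset ℂ) (φ f H : ℂ → ℂ) (P : ℂ[X]), 0 < M ∧ Z.card ≤ l ∧
      P.degree < (l + k : ℕ) ∧ DifferentiableOn ℂ H (padeU a b) ∧
      (∀ z ∈ padeU a b, φ z = (Y.map (fun y : ℝ => z - (y:ℂ))).prod * H z) ∧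
      (∀ z ∈ padeU a b, f z = P.eval z + φ z) ∧
      (∀ z, ∀ dz > 0, (∀ x ∈ Set.Icc a b, dz ≤ ‖z - (x:ℂ)‖) →
        ‖f z‖ ≤ M * (((1 + ‖z‖) ^ l + (L / δ) ^ (2 * l + k + 1) * (1 + (|a| + |b|)) ^ l) *
          s.real Set.univ / dz)) ∧
      (∀ z ∈ padeU a b, ∀ R τ : ℝ, 0 < τ → ‖z‖ ≤ R → (∀ ζ ∈ Z, τ ≤ ‖z - ζ‖) →
        M * ((τ / (1 + R + τ)) ^ l * ‖aeval z p / aeval z q - cauchy s z‖) ≤ ‖φ z‖) := by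
  obtain ⟨hC1, hC2⟩ := pade_C a b s hsupp q p w F hw0 hwr hF.continuousOn hFeq
    (by simpa using hlim 0 (Nat.zero_le _))
  have horth := pade_orth a b hab s hsupp q p w F hw0 hwr hF.continuousOn hFeq m hlim
  have hwF : ∀ z ∈ padeU a b, aeval z q * cauchy s z - aeval z p = aeval z w * F z := by
    intro z hz
    by_cases h : aeval z w = 0
    · rw [hC1 z hz, h, zero_mul, zero_mul]
    · rw [hFeq z hz h]; field_simp
  set N := 2 * l + k + 1 with hN
  set Y2 := Y.take N with hY2
  have hY2l : Y2.length = N := by rw [hY2, List.length_take]; omega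
  have hY2s : ∀ y ∈ Y2, y ∈ Y := fun y hy => List.mem_of_mem_take hy
  have haI : a ∈ Set.Icc a b := ⟨le_rfl, hab⟩
  have hσ : σ ≠ 0 := by
    rintro rfl
    have hpos : 0 < Y.length := by omega
    have := (hYδ _ (List.getElem_mem hpos) a haI).1
    simp at this
    linarith
  set w2 : ℝ[X] := (Y2.map (fun y => C σ * (X - C y))).prod with hw2
  have hw2eq : ∀ l : List ℝ, (l.map (fun y => C σ * (X - C y))).prod =
      C (σ ^ l.length) * (l.map (fun y => X - C y)).prod := by
    intro l
    induction l with
    | nil => simp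
    | cons y l ih => simp only [List.map_cons, List.prod_cons, ih, List.length_cons, pow_succ, C_mul]; ring
  have hdvd : w2 ∣ w := by
    rw [hw2, hw2eq]
    have h1 : ((Y2 : Multiset ℝ).map (fun y => X - C y)).prod ∣ w :=
      (Multiset.prod_X_sub_C_dvd_iff_le_roots hw0 _).2
        (le_trans (Multiset.coe_le.2 (List.take_sublist N Y).subperm) hY)
    have h2 : IsUnit (C (σ ^ Y2.length)) := isUnit_C.2 (isUnit_iff_ne_zero.2 (pow_ne_zero _ hσ))
    rw [h2.mul_left_dvd]
    simpa using h1
  obtain ⟨w1, hw1⟩ := hdvd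
  have hw2d : w2.natDegree = 2 * l + k + 1 := by
    rw [hw2, hw2eq, natDegree_C_mul (pow_ne_zero _ hσ)]
    have := natDegree_multiset_prod_X_sub_C_eq_card (Y2 : Multiset ℝ)
    simp only [Multiset.map_coe, Multiset.prod_coe, Multiset.coe_card] at this
    rw [this, hY2l]
  have hw2b : ∀ x ∈ Set.Icc a b, δ ^ N ≤ w2.eval x ∧ w2.eval x ≤ L ^ N := by
    intro x hx
    have : ∀ l : List ℝ, (∀ y ∈ l, δ ≤ σ * (x - y) ∧ σ * (x - y) ≤ L) →
        δ ^ l.length ≤ ((l.map (fun y => C σ * (X - C y))).prod).eval x ∧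
        ((l.map (fun y => C σ * (X - C y))).prod).eval x ≤ L ^ l.length := by
      intro l hl
      induction l with
      | nil => simp
      | cons y l ih =>
        have h1 := ih fun y hy => hl y (List.mem_cons_of_mem _ hy)
        have h2 := hl y List.mem_cons_self
        simp only [List.map_cons, List.prod_cons, List.length_cons, eval_mul, eval_C, eval_sub, eval_X] at h1 ⊢
        rw [pow_succ', pow_succ']
        have h3 : 0 < δ ^ l.length := pow_pos hδ _
        constructor
        · exact mul_le_mul h2.1 h1.1 h3.le (hδ.le.trans h2.1)
        · exact mul_le_mul h2.2 h1.2 (h3.le.trans h1.1) (hδ.le.trans (h2.1.trans h2.2))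
    have h := this Y2 fun y hy => hYδ y (hY2s y hy) x hx
    rwa [hY2l] at h
  obtain ⟨G, r, P, J, A, hG0, hGd, hJ, hqr, hPd, hpr, hA, hAs⟩ := pade_core a b s hsupp hinf q p w S g hS hq0 hq hg
    hw n m l k hn hqd hpd hwd horth hC2 w1 w2 (by rw [hw1, mul_comm]) hw0 hw2d (δ ^ N) (L ^ N) (pow_pos hδ _) hw2b
  obtain ⟨M, Z, hM, hZ, hup, hlow⟩ := pade_growth G hG0 l hGd
  have hab1 : ∀ x ∈ Set.Icc a b, |x| ≤ |a| + |b| := by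
    intro x hx
    rw [abs_le]
    constructor
    · linarith [hx.1, neg_abs_le a, abs_nonneg b]
    · linarith [hx.2, le_abs_self b, abs_nonneg a]
  have hAs' := hAs (M * (1 + (|a| + |b|)) ^ l) (by
    intro x hx
    have h1 := hup (x:ℂ)
    have h2 : aeval (x:ℂ) G = ((G.eval x : ℝ):ℂ) := by
      have := aeval_algebraMap_apply ℂ x G
      simpa using this
    rw [h2, Complex.norm_real, Complex.norm_real, Real.norm_eq_abs, Real.norm_eq_abs] at h1
    refine h1.trans ?_
    have := hab1 x hx
    gcongr)
  set Q : ℝ[X] := Lagrange.nodal J id with hQ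
  have hQ0 : ∀ z ∈ padeU a b, aeval z Q ≠ 0 := by
    intro z hz
    rw [hQ, Lagrange.nodal_eq, map_prod, Finset.prod_ne_zero_iff]
    intro i hi
    simp only [id, map_sub, aeval_X, aeval_C, Complex.coe_algebraMap]
    exact sub_ne_zero.2 (hz i (hJ i hi))
  obtain ⟨w', hw'⟩ := (Multiset.prod_X_sub_C_dvd_iff_le_roots hw0 _).2 hY
  have hWY : ∀ z : ℂ, aeval z ((Multiset.map (fun y => X - C y) (Y : Multiset ℝ)).prod) =
      (Y.map (fun y : ℝ => z - (y:ℂ))).prod := by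
    intro z
    simp only [Multiset.map_coe, Multiset.prod_coe]
    rw [map_list_prod, List.map_map]
    congr 1
    refine List.map_congr_left fun y _ => ?_
    simp
  refine ⟨M, Z, fun z => aeval z r / aeval z Q * (aeval z q * cauchy s z - aeval z p),
    fun z => aeval z G * cauchy s z - ∑ i ∈ J, (A i : ℂ) * (z - (i:ℂ))⁻¹,
    fun z => aeval z r / aeval z Q * aeval z w' * F z, P.map (algebraMap ℝ ℂ), hM, hZ, ?_, ?_, ?_, ?_, ?_, ?_⟩
  · rwa [degree_map]
  · have hd : ∀ R : ℝ[X], DifferentiableOn ℂ (fun z : ℂ => aeval z R) (padeU a b) := fun R =>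
      (Polynomial.differentiable_aeval R).differentiableOn
    exact (((hd r).div (hd Q) hQ0).mul (hd w')).mul hF
  · intro z hz
    simp only
    rw [hwF z hz]
    conv_lhs => rw [hw', map_mul, hWY]
    ring
  · intro z hz
    simp only
    have hq1 := congrArg (aeval z) hqr
    have hp1 := congrArg (aeval z) hpr
    simp only [map_mul, map_add, map_sum, aeval_C, Complex.coe_algebraMap] at hq1 hp1
    have h1 : ∀ i ∈ J, aeval z (Lagrange.nodal (J.erase i) id) = aeval z Q * (z - (i:ℂ))⁻¹ := by
      intro i hi
      have h2 : z - (i:ℂ) ≠ 0 := sub_ne_zero.2 (hz i (hJ i hi))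
      rw [hQ, Lagrange.nodal_eq_mul_nodal_erase hi, map_mul]
      simp only [id, map_sub, aeval_X, aeval_C, Complex.coe_algebraMap]
      field_simp
    rw [Finset.sum_congr rfl (fun i hi => by rw [h1 i hi])] at hp1
    have h3 : ∑ i ∈ J, (A i:ℂ) * (aeval z Q * (z - (i:ℂ))⁻¹) = aeval z Q * ∑ i ∈ J, (A i:ℂ) * (z - (i:ℂ))⁻¹ := by
      rw [Finset.mul_sum]; refine Finset.sum_congr rfl fun i _ => by ring
    rw [h3] at hp1
    have hz0 := hQ0 z hz
    rw [eval_map_algebraMap]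
    have : aeval z r / aeval z Q * (aeval z q * cauchy s z - aeval z p) =
      ((aeval z q * aeval z r) * cauchy s z - aeval z p * aeval z r) / aeval z Q := by ring
    rw [this, hq1, hp1]
    field_simp
    ring
  · intro z dz hdz hz
    have h1 : ‖cauchy s z‖ ≤ s.real Set.univ / dz := by
      have := pade_ct_bound a b s hsupp (fun _ => 1) continuousOn_const z dz hdz hz
      simpa [cauchy] using this
    have h2 : ‖∑ i ∈ J, (A i : ℂ) * (z - (i:ℂ))⁻¹‖ ≤ (∑ i ∈ J, A i) / dz := by
      refine (norm_sum_le _ _).trans ?_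
      rw [Finset.sum_div]
      refine Finset.sum_le_sum fun i hi => ?_
      rw [norm_mul, norm_inv, Complex.norm_real, Real.norm_eq_abs, abs_of_nonneg (hA i hi), div_eq_mul_inv]
      have := hz i (hJ i hi)
      have := hA i hi
      gcongr
    have h3 : (∑ i ∈ J, A i) / dz ≤ (L ^ N / δ ^ N * (M * (1 + (|a| + |b|)) ^ l) * s.real Set.univ) / dz := by
      gcongr
    calc _ ≤ ‖aeval z G * cauchy s z‖ + ‖∑ i ∈ J, (A i : ℂ) * (z - (i:ℂ))⁻¹‖ := norm_sub_le _ _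
      _ ≤ M * (1 + ‖z‖)^l * (s.real Set.univ / dz) +
          (L ^ N / δ ^ N * (M * (1 + (|a| + |b|)) ^ l) * s.real Set.univ) / dz := by
          refine add_le_add ?_ (h2.trans h3)
          rw [norm_mul]
          exact mul_le_mul (hup z) h1 (norm_nonneg _) (by positivity)
      _ = _ := by rw [div_pow]; ring
  · intro z hz R τ hτ hR hZτ
    have h1 := hlow z R τ hτ hR hZτ
    have hR0 : 0 ≤ R := (norm_nonneg z).trans hR
    have hG1 : aeval z G ≠ 0 := by
      intro h
      rw [h, norm_zero] at h1
      have : 0 < M * (τ / (1 + R + τ)) ^ l := by positivity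
      linarith
    have hq1 := congrArg (aeval z) hqr
    simp only [map_mul] at hq1
    have hQz := hQ0 z hz
    have hqz : aeval z q ≠ 0 := by
      intro h
      rw [h, zero_mul] at hq1
      exact (mul_ne_zero hQz hG1) hq1.symm
    have e : aeval z r / aeval z Q * (aeval z q * cauchy s z - aeval z p) =
        - (aeval z G * (aeval z p / aeval z q - cauchy s z)) := by
      have hG2 : aeval z G = aeval z q * aeval z r / aeval z Q := by
        rw [hq1]; field_simp
      rw [hG2]; field_simp; ring
    simp only
    rw [e, norm_neg, norm_mul, ← mul_assoc]
    exact mul_le_mul_of_nonneg_right h1 (norm_nonneg _)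

lemma pade_step1 (a b : ℝ) (hab : a ≤ b) (s : Measure ℝ) [IsFiniteMeasure s]
    (hsupp : s ((Set.Icc a b)ᶜ) = 0)
    (hinf : ∀ F : Finset ℝ, s ((↑F : Set ℝ))ᶜ ≠ 0)
    (q p w : ℝ[X]) (hq0 : q ≠ 0) (n m l k : ℕ) (hn : n = m + l)
    (hqd : q.natDegree ≤ n) (hpd : p.degree < (n + k : ℕ)) (hwd : w.natDegree ≤ 2 * n + k)
    (hw0 : w ≠ 0) (hwr : ∀ z : ℂ, aeval z w = 0 → z ∈ padeU a b)
    (F : ℂ → ℂ) (hF : DifferentiableOn ℂ F (padeU a b))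
    (hFeq : ∀ z ∈ padeU a b, aeval z w ≠ 0 →
        F z = (aeval z q * cauchy s z - aeval z p) / aeval z w)
    (hlim : ∀ k ≤ m, Tendsto (fun z => z ^ k * F z) (cocompact ℂ) (nhds 0))
    (Y : List ℝ) (hY : (Y : Multiset ℝ) ≤ w.roots) (hYc : 2 * l + k + 1 ≤ Y.length)
    (σ δ L : ℝ) (hδ : 0 < δ)
    (hYδ : ∀ y ∈ Y, ∀ x ∈ Set.Icc a b, δ ≤ σ * (x - y) ∧ σ * (x - y) ≤ L) :
    ∃ (M : ℝ) (Z : Multiset ℂ) (φ f H : ℂ → ℂ) (P : ℂ[X]), 0 < M ∧ Z.card ≤ l ∧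
      P.degree < (l + k : ℕ) ∧ DifferentiableOn ℂ H (padeU a b) ∧
      (∀ z ∈ padeU a b, φ z = (Y.map (fun y : ℝ => z - (y:ℂ))).prod * H z) ∧
      (∀ z ∈ padeU a b, f z = P.eval z + φ z) ∧
      (∀ z, ∀ dz > 0, (∀ x ∈ Set.Icc a b, dz ≤ ‖z - (x:ℂ)‖) →
        ‖f z‖ ≤ M * (((1 + ‖z‖) ^ l + (L / δ) ^ (2 * l + k + 1) * (1 + (|a| + |b|)) ^ l) *
          s.real Set.univ / dz)) ∧
      (∀ z ∈ padeU a b, ∀ R τ : ℝ, 0 < τ → ‖z‖ ≤ R → (∀ ζ ∈ Z, τ ≤ ‖z - ζ‖) →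
        M * ((τ / (1 + R + τ)) ^ l * ‖aeval z p / aeval z q - cauchy s z‖) ≤ ‖φ z‖) := by
  have hwne : ∀ x ∈ Set.Icc a b, w.eval x ≠ 0 := by
    intro x hx h
    have h1 : aeval (x:ℂ) w = ((w.eval x : ℝ):ℂ) := by
      have := aeval_algebraMap_apply ℂ x w
      simpa using this
    rw [h, Complex.ofReal_zero] at h1
    exact hwr _ h1 x hx rfl
  obtain ⟨S, g, hS, hqS, hg⟩ := pade_sign a b _ q hq0 rfl
  have hneg : ∀ k ≤ m, Tendsto (fun z => z ^ k * (-F) z) (cocompact ℂ) (nhds 0) := by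
    intro k hk
    have := (hlim k hk).neg
    rw [neg_zero] at this
    refine this.congr fun z => ?_
    simp
  have hFn : DifferentiableOn ℂ (-F) (padeU a b) := hF.neg
  have hwr' : ∀ z : ℂ, aeval z (-w) = 0 → z ∈ padeU a b := by
    intro z hz; rw [map_neg, neg_eq_zero] at hz; exact hwr z hz
  have hY' : (Y : Multiset ℝ) ≤ (-w).roots := by rwa [roots_neg]
  have hwd' : (-w).natDegree ≤ 2 * n + k := by rwa [natDegree_neg]
  have hqd' : (-q).natDegree ≤ n := by rwa [natDegree_neg]
  have hpd' : (-p).degree < (n + k : ℕ) := by rwa [degree_neg]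
  have hqS' : -q = Lagrange.nodal S id * (-g) := by rw [hqS]; ring
  rcases hg with hg | hg
  · rcases pade_const_sign a b w hwne with hw | hw
    · exact pade_step0 a b hab s hsupp hinf q p w S g hS hq0 hqS hg hw n m l k hn hqd hpd hwd hw0 hwr
        F hF hFeq hlim Y hY hYc σ δ L hδ hYδ
    · exact pade_step0 a b hab s hsupp hinf q p (-w) S g hS hq0 hqS hg (by
          intro x hx; have := hw x hx; rw [eval_neg]; linarith) n m l k hn hqd hpd hwd' (neg_ne_zero.2 hw0) hwr'
        (-F) hFn (by
          intro z hz hz0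
          rw [map_neg] at hz0 ⊢
          rw [Pi.neg_apply, hFeq z hz (neg_ne_zero.1 hz0), div_neg]) hneg Y hY' hYc σ δ L hδ hYδ
  · have hg' : ∀ x ∈ Set.Icc a b, 0 ≤ (-g).eval x := by
      intro x hx; have := hg x hx; rw [eval_neg]; linarith
    rcases pade_const_sign a b w hwne with hw | hw
    · have := pade_step0 a b hab s hsupp hinf (-q) (-p) w S (-g) hS (neg_ne_zero.2 hq0) hqS' hg' hw
        n m l k hn hqd' hpd' hwd hw0 hwr
        (-F) hFn (by
          intro z hz hz0
          rw [Pi.neg_apply, hFeq z hz hz0, map_neg, map_neg]; ring) hneg Y hY hYc σ δ L hδ hYδ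
      simpa only [map_neg, neg_div_neg_eq] using this
    · have := pade_step0 a b hab s hsupp hinf (-q) (-p) (-w) S (-g) hS (neg_ne_zero.2 hq0) hqS' hg' (by
          intro x hx; have := hw x hx; rw [eval_neg]; linarith) 
        n m l k hn hqd' hpd' hwd' (neg_ne_zero.2 hw0) hwr'
        F hF (by
          intro z hz hz0
          rw [map_neg] at hz0
          rw [hFeq z hz (neg_ne_zero.1 hz0), map_neg, map_neg, map_neg, ← neg_div_neg_eq]; ring) hlim Y hY' hYc σ δ L hδ hYδ
      simpa only [map_neg, neg_div_neg_eq] using this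

lemma pade_step (a b : ℝ) (hab : a ≤ b) (s : Measure ℝ) [IsFiniteMeasure s]
    (hsupp : s ((Set.Icc a b)ᶜ) = 0)
    (hinf : ∀ F : Finset ℝ, s ((↑F : Set ℝ))ᶜ ≠ 0)
    (q p w : ℝ[X]) (hq0 : q ≠ 0) (n l k : ℕ) (hn : l ≤ n)
    (hqd : q.natDegree ≤ n) (hpd : p.degree < (n + k : ℕ)) (hwd : w.natDegree ≤ 2 * n + k)
    (hw0 : w ≠ 0) (hwr : ∀ z : ℂ, aeval z w = 0 → z ∈ padeU a b)
    (F : ℂ → ℂ) (hF : DifferentiableOn ℂ F (padeU a b))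
    (hFeq : ∀ z ∈ padeU a b, aeval z w ≠ 0 →
        F z = (aeval z q * cauchy s z - aeval z p) / aeval z w)
    (C0 R0 : ℝ) (hlim : ∀ z : ℂ, R0 ≤ ‖z‖ → ‖F z‖ * ‖z‖ ^ (n + 1) ≤ C0 * ‖z‖ ^ l)
    (Y : List ℝ) (hY : (Y : Multiset ℝ) ≤ w.roots) (hYc : 2 * l + k + 1 ≤ Y.length)
    (σ δ L : ℝ) (hδ : 0 < δ)
    (hYδ : ∀ y ∈ Y, ∀ x ∈ Set.Icc a b, δ ≤ σ * (x - y) ∧ σ * (x - y) ≤ L) :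
    ∃ (Z : Multiset ℂ) (φ f H : ℂ → ℂ) (P : ℂ[X]), Z.card ≤ l ∧
      P.degree < (l + k : ℕ) ∧ DifferentiableOn ℂ H (padeU a b) ∧
      (∀ z, φ z = (Y.map (fun y : ℝ => z - (y:ℂ))).prod * H z) ∧
      (∀ z ∈ padeU a b, f z = P.eval z + φ z) ∧
      (∀ z, ∀ dz > 0, (∀ x ∈ Set.Icc a b, dz ≤ ‖z - (x:ℂ)‖) →
        ‖f z‖ ≤ (((1 + ‖z‖) ^ l + (L / δ) ^ (2 * l + k + 1) * (1 + (|a| + |b|)) ^ l) *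
          s.real Set.univ / dz)) ∧
      (∀ z ∈ padeU a b, ∀ R τ : ℝ, 0 < τ → ‖z‖ ≤ R → (∀ ζ ∈ Z, τ ≤ ‖z - ζ‖) →
        ((τ / (1 + R + τ)) ^ l * ‖aeval z p / aeval z q - cauchy s z‖) ≤ ‖φ z‖) := by
  obtain ⟨m, rfl⟩ : ∃ m, n = m + l := ⟨n - l, by omega⟩
  have hlim' : ∀ j ≤ m, Tendsto (fun z => z ^ j * F z) (cocompact ℂ) (nhds 0) := by
    intro j hj
    have h1 : Tendsto (fun z : ℂ => C0 / ‖z‖) (cocompact ℂ) (nhds 0) :=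
      tendsto_norm_cocompact_atTop.const_div_atTop _
    refine squeeze_zero_norm' ?_ h1
    have ht := tendsto_norm_cocompact_atTop (E := ℂ)
    filter_upwards [ht.eventually_ge_atTop R0, ht.eventually_ge_atTop 1] with z h2 h3
    have h4 := hlim z h2
    have hz : 0 < ‖z‖ := by linarith
    rw [norm_mul, norm_pow, le_div_iff₀ hz]
    have h5 : ‖z‖ ^ (m + l + 1) = ‖z‖ ^ (m + 1) * ‖z‖ ^ l := by ring
    rw [h5, ← mul_assoc] at h4
    have h6 := le_of_mul_le_mul_right h4 (by positivity)
    calc ‖z‖ ^ j * ‖F z‖ * ‖z‖ = ‖F z‖ * ‖z‖ ^ (j + 1) := by ring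
      _ ≤ ‖F z‖ * ‖z‖ ^ (m + 1) := by gcongr
      _ ≤ C0 := h6
  obtain ⟨M, Z, φ, f, H, P, hM, hZ, hP, hH, hφ, hf, hfb, hlow⟩ := pade_step1 a b hab s hsupp hinf q p w hq0 (m + l) m l k
    rfl hqd hpd hwd hw0 hwr F hF hFeq hlim' Y hY hYc σ δ L hδ hYδ
  have hMn : ‖((M⁻¹ : ℝ) : ℂ)‖ = M⁻¹ := by
    rw [Complex.norm_real, Real.norm_eq_abs, abs_of_pos (inv_pos.2 hM)]
  have hφ' : ∀ z ∈ padeU a b, (Y.map (fun y : ℝ => z - (y:ℂ))).prod * (((M⁻¹ : ℝ) : ℂ) * H z) =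
      ((M⁻¹ : ℝ) : ℂ) * φ z := by
    intro z hz; rw [hφ z hz]; ring
  refine ⟨Z, fun z => (Y.map (fun y : ℝ => z - (y:ℂ))).prod * (((M⁻¹ : ℝ) : ℂ) * H z),
    fun z => ((M⁻¹ : ℝ) : ℂ) * f z, fun z => ((M⁻¹ : ℝ) : ℂ) * H z,
    C ((M⁻¹ : ℝ) : ℂ) * P, hZ, ?_, hH.const_mul _, fun z => rfl, ?_, ?_, ?_⟩
  · rw [← smul_eq_C_mul]
    exact lt_of_le_of_lt (degree_smul_le _ _) hP
  · intro z hz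
    simp only
    rw [hφ' z hz, hf z hz, eval_mul, eval_C]; ring
  · intro z dz hdz hz
    simp only
    rw [norm_mul, hMn, inv_mul_le_iff₀ hM]
    exact hfb z dz hdz hz
  · intro z hz R τ hτ hR hZτ
    simp only
    rw [hφ' z hz, norm_mul, hMn, le_inv_mul_iff₀ hM]
    exact hlow z hz R τ hτ hR hZτ

/-- Convergence in Hausdorff content of incomplete diagonal multi-point Padé
approximants (Lemma of Bustamante–López type). -/
theorem stmt13 (a b : ℝ) (hab : a ≤ b) (s : Measure ℝ) [IsFiniteMeasure s]
    (hsupp : s ((Set.Icc a b)ᶜ) = 0)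
    (hinf : ∀ F : Finset ℝ, s ((↑F : Set ℝ))ᶜ ≠ 0)
    (κ : ℤ) (hκ : -1 ≤ κ) (l : ℕ)
    (q p w : ℕ → Polynomial ℝ)
    (hq0 : ∀ n, q n ≠ 0)
    (hqdeg : ∀ n, (q n).natDegree ≤ n)
    (hpdeg : ∀ n, p n ≠ 0 → ((p n).natDegree : ℤ) ≤ (n : ℤ) + κ)
    (hw0 : ∀ n, w n ≠ 0)
    (hwdeg : ∀ n, ((w n).natDegree : ℤ) ≤ 2 * (n : ℤ) + κ + 1)
    (hwroots : ∀ n, ∀ z : ℂ, aeval z (w n) = 0 → ∃ x : ℝ, (x : ℂ) = z ∧ x ∉ Set.Icc a b)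
    (hol : ∀ n : ℕ, ∃ F : ℂ → ℂ,
      DifferentiableOn ℂ F {z : ℂ | ∀ x ∈ Set.Icc a b, z ≠ (x : ℂ)} ∧
      (∀ z : ℂ, (∀ x ∈ Set.Icc a b, z ≠ (x : ℂ)) → aeval z (w n) ≠ 0 →
        F z = (aeval z (q n) * cauchy s z - aeval z (p n)) / aeval z (w n)) ∧
      ∃ C R : ℝ, ∀ z : ℂ, R ≤ ‖z‖ → ‖F z‖ * ‖z‖ ^ (n + 1) ≤ C * ‖z‖ ^ l)
    (c d : ℝ) (hseg : Set.Icc c d ∩ Set.Icc a b = ∅)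
    (hcount : Tendsto
      (fun n => (Multiset.filter (fun x => x ∈ Set.Icc c d) (w n).roots).card)
      atTop atTop) :
    ∀ K : Set ℂ, IsCompact K → (∀ z ∈ K, ∀ x ∈ Set.Icc a b, z ≠ (x : ℂ)) →
      ∀ ε > (0:ℝ),
      Tendsto (fun n => hcont {z ∈ K | ε < ‖aeval z (p n) / aeval z (q n) - cauchy s z‖})
        atTop (nhds 0) := by
  obtain ⟨k, hk⟩ : ∃ k : ℕ, (k : ℤ) = κ + 1 := ⟨(κ + 1).toNat, by omega⟩
  have hcd : c ≤ d := by
    by_contra h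
    have h1 : Set.Icc c d = ∅ := Set.Icc_eq_empty h
    obtain ⟨n, hn⟩ := (hcount.eventually_ge_atTop 1).exists
    simp [h1] at hn
  obtain ⟨x0, e, ρ, δ, θ, r, σ, hρ, hδ, hθ0, hθ1, hr, hball, her, hgeo, hσ, hgap⟩ := pade_geom a b c d hab hcd hseg
  set Yl : ℕ → List ℝ := fun n => (Multiset.filter (fun x => x ∈ Set.Icc c d) (w n).roots).toList with hYl
  have hYmem : ∀ n, ∀ y ∈ Yl n, y ∈ Set.Icc c d := by
    intro n y hy
    rw [hYl, Multiset.mem_toList] at hy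
    exact (Multiset.mem_filter.1 hy).2
  have hYlen : Tendsto (fun n => (Yl n).length) atTop atTop := by
    refine hcount.congr fun n => ?_
    rw [hYl, Multiset.length_toList]
  set L : ℝ := |a| + |b| + |c| + |d| with hL
  have hYδ : ∀ n, ∀ y ∈ Yl n, ∀ x ∈ Set.Icc a b, δ ≤ σ * (x - y) ∧ σ * (x - y) ≤ L := by
    intro n y hy x hx
    have hy' := hYmem n y hy
    refine ⟨hgap y hy' x hx, ?_⟩
    refine (le_abs_self _).trans ?_
    rw [abs_mul, hσ, one_mul, abs_le, hL]
    constructor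
    · linarith [hx.1, hy'.2, neg_abs_le a, le_abs_self d, abs_nonneg b, abs_nonneg c]
    · linarith [hx.2, hy'.1, neg_abs_le c, le_abs_self b, abs_nonneg a, abs_nonneg d]
  have hstep : ∀ n, ∃ (Z : Multiset ℂ) (φ f H : ℂ → ℂ) (P : ℂ[X]), l ≤ n ∧ 2 * l + k + 1 ≤ (Yl n).length →
      Z.card ≤ l ∧
      P.degree < (l + k : ℕ) ∧ DifferentiableOn ℂ H (padeU a b) ∧
      (∀ z, φ z = ((Yl n).map (fun y : ℝ => z - (y:ℂ))).prod * H z) ∧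
      (∀ z ∈ padeU a b, f z = P.eval z + φ z) ∧
      (∀ z, ∀ dz > 0, (∀ x ∈ Set.Icc a b, dz ≤ ‖z - (x:ℂ)‖) →
        ‖f z‖ ≤ (((1 + ‖z‖) ^ l + (L / δ) ^ (2 * l + k + 1) * (1 + (|a| + |b|)) ^ l) *
          s.real Set.univ / dz)) ∧
      (∀ z ∈ padeU a b, ∀ R τ : ℝ, 0 < τ → ‖z‖ ≤ R → (∀ ζ ∈ Z, τ ≤ ‖z - ζ‖) →
        ((τ / (1 + R + τ)) ^ l * ‖aeval z (p n) / aeval z (q n) - cauchy s z‖) ≤ ‖φ z‖) := by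
    intro n
    by_cases h : l ≤ n ∧ 2 * l + k + 1 ≤ (Yl n).length
    swap
    · exact ⟨0, 0, 0, 0, 0, fun h' => absurd h' h⟩
    obtain ⟨F, hF, hFeq, C0, R0, hlim⟩ := hol n
    obtain ⟨Z, φ, f, H, P, hh⟩ := pade_step a b hab s hsupp hinf (q n) (p n) (w n) (hq0 n) n l k h.1 (hqdeg n)
      (by
        by_cases hp0 : p n = 0
        · rw [hp0, degree_zero]; exact WithBot.bot_lt_coe _
        · rw [← natDegree_lt_iff_degree_lt hp0]
          have := hpdeg n hp0
          omega) (by have := hwdeg n; omega) (hw0 n)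
      (by
        intro z hz x hx hzx
        obtain ⟨y, hy, hy'⟩ := hwroots n z hz
        rw [hzx] at hy
        exact hy' ((Complex.ofReal_injective hy) ▸ hx)) F hF hFeq C0 R0 hlim (Yl n)
      (by rw [hYl, Multiset.coe_toList]; exact Multiset.filter_le _ _) h.2 σ δ L hδ (hYδ n)
    exact ⟨Z, φ, f, H, P, fun _ => hh⟩
  choose Z φ f H P hmain using hstep
  have hev : ∀ᶠ n in atTop, l ≤ n ∧ 2 * l + k + 1 ≤ (Yl n).length :=
    (eventually_ge_atTop l).and (hYlen.eventually_ge_atTop _)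
  have hL0 : 0 ≤ L := by positivity
  have hfb : ∀ K ⊆ padeU a b, IsCompact K → ∃ C, ∀ᶠ n in atTop, ∀ z ∈ K, ‖f n z‖ ≤ C := by
    intro K hKU hK
    obtain ⟨dz, hdz, hd⟩ := pade_dist a b K hK hKU
    obtain ⟨R, hR⟩ := hK.isBounded.exists_norm_le
    refine ⟨((1 + R) ^ l + (L / δ) ^ (2 * l + k + 1) * (1 + (|a| + |b|)) ^ l) * s.real Set.univ / dz, ?_⟩
    filter_upwards [hev] with n hn z hz
    obtain ⟨_, _, _, _, _, h, _⟩ := hmain n hn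
    refine (h z dz hdz (hd z hz)).trans ?_
    have := hR z hz
    gcongr
  obtain ⟨CB, hCB⟩ := hfb _ hball (isCompact_closedBall x0 ρ)
  have hprod : ∀ (ys : List ℝ) (z : ℂ), ((ys.map (fun y : ℝ => (y:ℂ))).map (fun y => z - y)).prod =
      (ys.map (fun y : ℝ => z - (y:ℂ))).prod := by
    intro ys z; rw [List.map_map]; rfl
  have hφd : ∀ᶠ n in atTop, DifferentiableOn ℂ (φ n) (padeU a b) := by
    filter_upwards [hev] with n hn
    obtain ⟨_, _, hH, hφ, _, _, _⟩ := hmain n hn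
    have : φ n = fun z => ((Yl n).map (fun y : ℝ => z - (y:ℂ))).prod * H n z := funext hφ
    rw [this]
    refine DifferentiableOn.mul ?_ hH
    have : ∀ ys : List ℝ, Differentiable ℂ (fun z : ℂ => (ys.map (fun y : ℝ => z - (y:ℂ))).prod) := by
      intro ys
      induction ys with
      | nil => simp
      | cons y ys ih =>
        simp only [List.map_cons, List.prod_cons]
        exact (differentiable_id.sub_const _).mul ih
    exact (this _).differentiableOn
  have hPb : ∀ R : ℝ, ∃ C, ∀ᶠ n in atTop, ∀ z : ℂ, ‖z‖ ≤ R → ‖(P n).eval z‖ ≤ C := by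
    intro R
    obtain ⟨C1, hC1, hC1'⟩ := pade_hermite x0 ρ δ (|c| + |d|) hρ hδ ((fun y : ℝ => (y:ℂ)) '' Set.Icc c d) (by
      rintro _ ⟨y, hy, rfl⟩
      refine ⟨(hgeo y hy).1, ?_, (hgeo y hy).2.1⟩
      simp only
      rw [Complex.norm_real, Real.norm_eq_abs, abs_le]
      constructor
      · linarith [hy.1, neg_abs_le c, abs_nonneg d]
      · linarith [hy.2, le_abs_self d, abs_nonneg c]) R (l + k)
    refine ⟨C1 * CB, ?_⟩
    filter_upwards [hev, hCB] with n hn hB z hz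
    obtain ⟨_, hP, hH, hφ, hf, _, _⟩ := hmain n hn
    have hdd : ∀ ys : List ℝ, Differentiable ℂ (fun z : ℂ => (ys.map (fun y : ℝ => z - (y:ℂ))).prod) := by
      intro ys
      induction ys with
      | nil => simp
      | cons y ys ih =>
        simp only [List.map_cons, List.prod_cons]
        exact (differentiable_id.sub_const _).mul ih
    refine hC1' (((Yl n).take (l + k)).map (fun y : ℝ => (y:ℂ))) (P n) (f n)
      (fun z => (((Yl n).drop (l + k)).map (fun y : ℝ => z - (y:ℂ))).prod * H n z) CB ?_ ?_ hP ?_ ?_ hB z hz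
    · intro y hy
      obtain ⟨y', hy', rfl⟩ := List.mem_map.1 hy
      exact ⟨y', hYmem n y' (List.mem_of_mem_take hy'), rfl⟩
    · rw [List.length_map, List.length_take]; omega
    · exact (hdd _).differentiableOn.mul (hH.mono hball)
    · intro z hz
      rw [hf z (hball hz), hφ z, hprod, ← mul_assoc, ← List.prod_append, ← List.map_append, List.take_append_drop]
  have hφb : ∀ K ⊆ padeU a b, IsCompact K → ∃ C, ∀ᶠ n in atTop, ∀ z ∈ K, ‖φ n z‖ ≤ C := by
    intro K hKU hK
    obtain ⟨C1, h1⟩ := hfb K hKU hK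
    obtain ⟨R, hR⟩ := hK.isBounded.exists_norm_le
    obtain ⟨C2, h2⟩ := hPb R
    refine ⟨C1 + C2, ?_⟩
    filter_upwards [hev, h1, h2] with n hn h1 h2 z hz
    obtain ⟨_, _, _, _, hf, _, _⟩ := hmain n hn
    have : φ n z = f n z - (P n).eval z := by rw [hf z (hKU hz)]; ring
    rw [this]
    exact (norm_sub_le _ _).trans (add_le_add (h1 z hz) (h2 z (hR z hz)))
  obtain ⟨C3, hC3⟩ := hφb _ hball (isCompact_closedBall x0 ρ)
  have h0 : ∀ ε > 0, ∀ᶠ n in atTop, ∀ z ∈ Metric.ball e r, ‖φ n z‖ ≤ ε := by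
    intro ε hε
    have h1 : Tendsto (fun n => θ ^ (Yl n).length * C3) atTop (nhds 0) := by
      have := ((tendsto_pow_atTop_nhds_zero_of_lt_one hθ0 hθ1).comp hYlen).mul_const C3
      simpa using this
    filter_upwards [hev, hC3, h1.eventually_le_const hε] with n hn h3 h4 z hz
    obtain ⟨_, _, hH, hφ, _, _, _⟩ := hmain n hn
    have := pade_small x0 ρ θ hρ hθ0 z (her hz) ((Yl n).map (fun y : ℝ => (y:ℂ))) (by
      intro y hy t ht
      obtain ⟨y', hy', rfl⟩ := List.mem_map.1 hy
      exact (hgeo y' (hYmem n y' hy')).2.2 t ht z hz) (φ n) (H n) C3 (hH.mono hball)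
      (by intro z _; rw [hφ z, hprod]) h3
    rw [List.length_map] at this
    exact this.trans h4
  have hvit := pade_vitali (padeU a b) (padeU_open a b) (padeU_preconn a b) φ hφd hφb e
    (hball (her (Metric.mem_ball_self hr))) r hr h0
  intro K hK hKU ε hε
  have hKU' : K ⊆ padeU a b := fun z hz => hKU z hz
  rw [ENNReal.tendsto_nhds_zero]
  intro η hη
  obtain ⟨τ, hτ, hτη⟩ : ∃ τ : ℝ, 0 < τ ∧ (l : ENNReal) * ENNReal.ofReal τ ≤ η := by
    by_cases htop : η = ⊤
    · exact ⟨1, one_pos, by rw [htop]; exact le_top⟩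
    have hη' : 0 < η.toReal := ENNReal.toReal_pos hη.ne' htop
    refine ⟨η.toReal / (l + 1), by positivity, ?_⟩
    rw [← ENNReal.ofReal_natCast, ← ENNReal.ofReal_mul (by positivity)]
    refine ENNReal.ofReal_le_of_le_toReal ?_
    rw [mul_div_assoc', div_le_iff₀ (by positivity)]
    nlinarith
  obtain ⟨R, hR⟩ := hK.isBounded.exists_norm_le
  rcases K.eq_empty_or_nonempty with hKe | ⟨z1, hz1⟩
  · refine Eventually.of_forall fun n => ?_
    refine (pade_hcont_le _ 0 l (by simp) τ ?_).trans hτη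
    rintro z ⟨hz, _⟩
    rw [hKe] at hz; exact hz.elim
  have hR0 : 0 ≤ R := (norm_nonneg _).trans (hR z1 hz1)
  filter_upwards [hev, hvit K hKU' hK (ε * (τ / (1 + R + τ)) ^ l) (by positivity)] with n hn hsm
  obtain ⟨hZ, _, _, _, _, _, hlow⟩ := hmain n hn
  refine (pade_hcont_le _ (Z n) l hZ τ ?_).trans hτη
  rintro z ⟨hz, hbad⟩
  by_contra hc
  push Not at hc
  have h1 := hlow z (hKU' hz) R τ hτ (hR z hz) hc
  have h2 := hsm z hz
  have h3 : 0 < (τ / (1 + R + τ)) ^ l := by positivity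
  have h4 := mul_lt_mul_of_pos_left hbad h3
  linarith
end
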